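/- arXiv:2108.08655 — 2 statements merged into one kernel-verified Lean document; each statement's English description precedes it below -/
import Mathlib

section
/- Assume the initial distribution satisfies μ(x) > 0 for all states x. Then along the limit ODE system the actor converges to the optimal policy at rate J(f*) − J(f_{θ̄_t}) = O(1/log t) as t → ∞, where f* is any optimal policy. -/
open MeasureTheory Filter Set
open scoped Classical

noncomputable section

def softmaxPol {X A : Type*} [Fintype A] (θ : X → A → ℝ) (x : X) (a : A) : ℝ :=
  Real.exp (θ x a) / ∑ a', Real.exp (θ x a')

def explorePol {X A : Type*} [Fintype A] (η : ℝ) (θ : X → A → ℝ) (x : X) (a : A) : ℝ :=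
  η / (Fintype.card A : ℝ) + (1 - η) * softmaxPol θ x a

def zetaN (N k : ℕ) : ℝ := (1 + (k : ℝ) / (N : ℝ))⁻¹

def etaN (N k : ℕ) : ℝ := (1 + (Real.log ((k : ℝ) / (N : ℝ) + 1)) ^ 2)⁻¹

def zetaT (t : ℝ) : ℝ := (1 + t)⁻¹

def etaT (t : ℝ) : ℝ := (1 + (Real.log (t + 1)) ^ 2)⁻¹

def IsPolicy {X A : Type*} [Fintype A] (f : X → A → ℝ) : Prop :=
  (∀ x a, 0 ≤ f x a) ∧ ∀ x, ∑ a, f x a = 1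

def ptilde {X A : Type*} (γ : ℝ) (p : X → A → X → ℝ) (μ : X → ℝ)
    (x : X) (a : A) (x' : X) : ℝ :=
  γ * p x a x' + (1 - γ) * μ x'

def actorKer {X A : Type*} (γ : ℝ) (p : X → A → X → ℝ) (μ : X → ℝ) (f : X → A → ℝ) :
    X × A → X × A → ℝ :=
  fun ξ ξ' => ptilde γ p μ ξ.1 ξ.2 ξ'.1 * f ξ'.1 ξ'.2

def criticKer {X A : Type*} (p : X → A → X → ℝ) (g : X → A → ℝ) :
    X × A → X × A → ℝ :=
  fun ξ ξ' => p ξ.1 ξ.2 ξ'.1 * g ξ'.1 ξ'.2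

def kpow {S : Type*} [Fintype S] [DecidableEq S] (K : S → S → ℝ) : ℕ → S → S → ℝ
  | 0 => fun ξ ξ' => if ξ = ξ' then 1 else 0
  | n + 1 => fun ξ ξ' => ∑ y, K ξ y * kpow K n y ξ'

def IsStationaryDist {S : Type*} [Fintype S] (K : S → S → ℝ) (d : S → ℝ) : Prop :=
  (∀ ξ, 0 ≤ d ξ) ∧ (∑ ξ, d ξ = 1) ∧ ∀ ξ', d ξ' = ∑ ξ, d ξ * K ξ ξ'

def pathSum {X A : Type*} [Fintype X] [Fintype A] [DecidableEq X]
    (p : X → A → X → ℝ) : ℕ → X → A → X → ℝ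
  | 0 => fun x _ x' => if x = x' then 1 else 0
  | 1 => fun x a x' => p x a x'
  | n + 2 => fun x a x' => ∑ x₁ : X, ∑ a₁ : A, p x a x₁ * pathSum p (n + 1) x₁ a₁ x'

open scoped Topology

theorem HasDerivAt.eventually_gt_right {w : ℝ → ℝ} {w' x : ℝ} (h : HasDerivAt w w' x)
    (hw : 0 < w') : ∀ᶠ s in 𝓝[>] x, w x < w s := by
  have h1 := (hasDerivAt_iff_tendsto_slope.1 h).eventually (lt_mem_nhds hw)
  have h2 : ∀ᶠ s in 𝓝[>] x, 0 < slope w x s :=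
    h1.filter_mono (nhdsWithin_mono _ fun s (hs : x < s) => hs.ne')
  filter_upwards [h2, self_mem_nhdsWithin] with s hs (hxs : x < s)
  rw [slope_def_field] at hs
  have := (div_pos_iff_of_pos_right (sub_pos.2 hxs)).1 hs
  linarith

/-- A finite family starting below a barrier stays below it, provided that every member touching
the barrier has a strictly smaller derivative. -/
theorem family_le_barrier {ι : Type*} [Finite ι] {u u' : ι → ℝ → ℝ} {B B' : ℝ → ℝ} {T : ℝ}
    (hu : ∀ i, ∀ s, T ≤ s → HasDerivAt (u i) (u' i s) s)
    (hB : ∀ s, T ≤ s → HasDerivAt B (B' s) s)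
    (h0 : ∀ i, u i T ≤ B T)
    (h : ∀ s, T ≤ s → (∀ j, u j s ≤ B s) → ∀ i, u i s = B s → u' i s < B' s) :
    ∀ s, T ≤ s → ∀ i, u i s ≤ B s := by
  intro b hb
  have key : Icc T b ⊆ {s | ∀ i, u i s ≤ B s} := by
    apply IsClosed.Icc_subset_of_forall_exists_gt
    · have : {s | ∀ i, u i s ≤ B s} ∩ Icc T b
          = Icc T b ∩ ⋂ i, {s | s ∈ Icc T b ∧ u i s ≤ B s} := by
        ext s
        simp only [mem_inter_iff, mem_ofPred_eq, mem_iInter]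
        grind
      rw [this]
      refine isClosed_Icc.inter (isClosed_iInter fun i => isClosed_Icc.isClosed_le ?_ ?_)
      · exact fun s hs => (hu i s hs.1).continuousAt.continuousWithinAt
      · exact fun s hs => (hB s hs.1).continuousAt.continuousWithinAt
    · exact h0
    · rintro x ⟨hx, hxT, hxb⟩ y hy
      have hev : ∀ᶠ s in 𝓝[>] x, ∀ i, u i s ≤ B s := by
        rw [eventually_all]
        intro i
        have hd := (hB x hxT).fun_sub (hu i x hxT)
        rcases (hx i).lt_or_eq with hlt | heq
        · have := hd.continuousAt.eventually (lt_mem_nhds (sub_pos.2 hlt))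
          filter_upwards [nhdsWithin_le_nhds this] with s hs
          linarith
        · filter_upwards [hd.eventually_gt_right (sub_pos.2 (h x hxT hx i heq))] with s hs
          linarith
      have h2 : ∀ᶠ s in 𝓝[>] x, s ∈ Ioc x y := Ioc_mem_nhdsGT hy
      exact (hev.and h2).exists
  exact key ⟨hb, le_rfl⟩

theorem le_barrier {u u' B B' : ℝ → ℝ} {T : ℝ}
    (hu : ∀ s, T ≤ s → HasDerivAt u (u' s) s) (hB : ∀ s, T ≤ s → HasDerivAt B (B' s) s)
    (h0 : u T ≤ B T) (h : ∀ s, T ≤ s → u s = B s → u' s < B' s) :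
    ∀ s, T ≤ s → u s ≤ B s := fun s hs =>
  family_le_barrier (ι := Unit) (u := fun _ => u) (u' := fun _ => u') (fun _ => hu) hB
    (fun _ => h0) (fun s hs _ _ => h s hs) s hs ()

theorem le_of_hasDerivAt_nonneg {u u' : ℝ → ℝ} {T : ℝ}
    (hu : ∀ s, T ≤ s → HasDerivAt u (u' s) s) (h : ∀ s, T ≤ s → 0 ≤ u' s) {s t : ℝ}
    (hs : T ≤ s) (hst : s ≤ t) : u s ≤ u t := by
  refine monotoneOn_of_deriv_nonneg (convex_Ici T) (fun x hx => ?_) (fun x hx => ?_)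
    (fun x hx => ?_) hs (hs.trans hst) hst
  · exact (hu x hx).continuousAt.continuousWithinAt
  · rw [interior_Ici] at hx
    exact (hu x (le_of_lt hx)).differentiableAt.differentiableWithinAt
  · rw [interior_Ici] at hx
    rw [(hu x (le_of_lt hx)).deriv]
    exact h x (le_of_lt hx)

theorem ge_of_hasDerivAt_nonpos {u u' : ℝ → ℝ} {T : ℝ}
    (hu : ∀ s, T ≤ s → HasDerivAt u (u' s) s) (h : ∀ s, T ≤ s → u' s ≤ 0) {s t : ℝ}
    (hs : T ≤ s) (hst : s ≤ t) : u t ≤ u s := by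
  have := le_of_hasDerivAt_nonneg (u := fun s => -u s) (fun s hs => (hu s hs).fun_neg)
    (fun s hs => neg_nonneg.2 (h s hs)) hs hst
  linarith

theorem softmaxPol_pos {X A : Type*} [Fintype A] [Nonempty A] (θ : X → A → ℝ) (x : X) (a : A) :
    0 < softmaxPol θ x a :=
  div_pos (Real.exp_pos _) (Finset.sum_pos (fun _ _ => Real.exp_pos _) Finset.univ_nonempty)

theorem softmaxPol_sum {X A : Type*} [Fintype A] [Nonempty A] (θ : X → A → ℝ) (x : X) :
    ∑ a, softmaxPol θ x a = 1 := by
  unfold softmaxPol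
  rw [← Finset.sum_div, div_self]
  exact (Finset.sum_pos (fun _ _ => Real.exp_pos _) Finset.univ_nonempty).ne'

theorem isPolicy_softmaxPol {X A : Type*} [Fintype A] [Nonempty A] (θ : X → A → ℝ) :
    IsPolicy (softmaxPol θ) :=
  ⟨fun x a => (softmaxPol_pos θ x a).le, softmaxPol_sum θ⟩

theorem IsPolicy.le_one {X A : Type*} [Fintype A] {f : X → A → ℝ} (hf : IsPolicy f) (x : X)
    (a : A) : f x a ≤ 1 := by
  rw [← hf.2 x]
  exact Finset.single_le_sum (fun b _ => hf.1 x b) (Finset.mem_univ a)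

theorem softmaxPol_eq_mul {X A : Type*} [Fintype A] (θ : X → A → ℝ) (x : X)
    (a b : A) : softmaxPol θ x a = Real.exp (θ x a - θ x b) * softmaxPol θ x b := by
  unfold softmaxPol
  rw [← mul_div_assoc, ← Real.exp_add, sub_add_cancel]

theorem hasDerivAt_softmaxPol {X A : Type*} [Fintype A] [Nonempty A] {θ : ℝ → X → A → ℝ}
    {θ' : A → ℝ} {s : ℝ} {x : X} (h : ∀ a, HasDerivAt (fun s => θ s x a) (θ' a) s) (a : A) :
    HasDerivAt (fun s => softmaxPol (θ s) x a)
      (softmaxPol (θ s) x a * (θ' a - ∑ b, softmaxPol (θ s) x b * θ' b)) s := by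
  have hpos : 0 < ∑ b, Real.exp (θ s x b) :=
    Finset.sum_pos (fun _ _ => Real.exp_pos _) Finset.univ_nonempty
  have h1 := ((h a).exp).fun_div (HasDerivAt.fun_sum (u := Finset.univ) fun b _ => (h b).exp) hpos.ne'
  refine h1.congr_deriv ?_
  have : ∑ b, softmaxPol (θ s) x b * θ' b
      = (∑ b, Real.exp (θ s x b) * θ' b) / ∑ b, Real.exp (θ s x b) := by
    rw [Finset.sum_div]
    exact Finset.sum_congr rfl fun b _ => by unfold softmaxPol; ring
  rw [this]
  unfold softmaxPol
  field_simp

/-- A discounted maximum principle. -/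
theorem le_div_of_le_add_discounted {ι : Type*} [Fintype ι] {K : ι → ι → ℝ} {γ h : ℝ}
    (hγ0 : 0 ≤ γ) (hγ1 : γ < 1) (hK0 : ∀ i j, 0 ≤ K i j) (hK1 : ∀ i, ∑ j, K i j = 1)
    {u : ι → ℝ} (hu : ∀ i, u i ≤ h + γ * ∑ j, K i j * u j) (i : ι) : u i ≤ h / (1 - γ) := by
  have : Nonempty ι := ⟨i⟩
  obtain ⟨m, hm⟩ := Finite.exists_max u
  have h1 : ∑ j, K m j * u j ≤ u m := by
    calc ∑ j, K m j * u j ≤ ∑ j, K m j * u m :=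
          Finset.sum_le_sum fun j _ => mul_le_mul_of_nonneg_left (hm j) (hK0 m j)
      _ = u m := by rw [← Finset.sum_mul, hK1, one_mul]
  have h2 := hu m
  rw [le_div_iff₀ (by linarith)]
  nlinarith [hm i, mul_le_mul_of_nonneg_left h1 hγ0]

theorem abs_le_div_of_eq_add_discounted {ι : Type*} [Fintype ι] {K : ι → ι → ℝ} {γ h : ℝ}
    (hγ0 : 0 ≤ γ) (hγ1 : γ < 1) (hK0 : ∀ i j, 0 ≤ K i j) (hK1 : ∀ i, ∑ j, K i j = 1)
    {u c : ι → ℝ} (hu : ∀ i, u i = c i + γ * ∑ j, K i j * u j) (hc : ∀ i, |c i| ≤ h) (i : ι) :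
    |u i| ≤ h / (1 - γ) := by
  rw [abs_le']
  constructor
  · refine le_div_of_le_add_discounted hγ0 hγ1 hK0 hK1 (fun i => ?_) i
    rw [hu i]
    linarith [le_abs_self (c i), hc i]
  · refine le_div_of_le_add_discounted (u := fun i => -u i) hγ0 hγ1 hK0 hK1 (fun i => ?_) i
    simp only [mul_neg, Finset.sum_neg_distrib]
    rw [hu i]
    linarith [neg_abs_le (c i), hc i]

/-- The solution of a discounted linear system depends differentiably on its coefficients. -/
theorem differentiableAt_of_discounted {ι : Type*} [Fintype ι] {γ : ℝ} (hγ0 : 0 ≤ γ) (hγ1 : γ < 1)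
    {K : ℝ → ι → ι → ℝ} {c V : ℝ → ι → ℝ} (hK0 : ∀ s i j, 0 ≤ K s i j)
    (hK1 : ∀ s i, ∑ j, K s i j = 1) (hV : ∀ s i, V s i = c s i + γ * ∑ j, K s i j * V s j)
    {s : ℝ} (hK : ∀ i j, DifferentiableAt ℝ (fun s => K s i j) s)
    (hc : ∀ i, DifferentiableAt ℝ (fun s => c s i) s) (i : ι) :
    DifferentiableAt ℝ (fun s => V s i) s := by
  let M : ℝ → Matrix ι ι ℝ := fun s => Matrix.of fun i j => (if i = j then 1 else 0) - γ * K s i j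
  have hmul : ∀ s v i, (M s).mulVec v i = v i - γ * ∑ j, K s i j * v j := by
    intro s v i
    simp only [Matrix.mulVec, dotProduct, M, Matrix.of_apply, sub_mul, Finset.sum_sub_distrib,
      ite_mul, one_mul, zero_mul, Finset.sum_ite_eq, Finset.mem_univ, if_true, Finset.mul_sum,
      mul_assoc]
  have hinj : ∀ s v, (M s).mulVec v = 0 → v = 0 := by
    intro s v hv
    ext i
    have := abs_le_div_of_eq_add_discounted (u := v) (c := fun _ => 0) (h := 0) hγ0 hγ1 (hK0 s)
      (hK1 s) (fun i => by have := congrFun hv i; rw [hmul] at this; simpa using sub_eq_zero.1 this)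
      (by simp) i
    simpa using this
  have hdet : ∀ s, (M s).det ≠ 0 := by
    intro s h0
    obtain ⟨v, hv, hv0⟩ := Matrix.exists_mulVec_eq_zero_iff.2 h0
    exact hv (hinj s v hv0)
  have hcr : ∀ s, (M s).det • V s = (M s).cramer (c s) := by
    intro s
    rw [← sub_eq_zero]
    apply hinj s
    rw [Matrix.mulVec_sub, Matrix.mulVec_cramer, Matrix.mulVec_smul, ← smul_sub]
    have : (M s).mulVec (V s) - c s = 0 := by
      ext i
      rw [Pi.sub_apply, hmul, hV s i]
      simp only [Pi.zero_apply]
      rw [← hV s i]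
      linarith [hV s i]
    rw [this, smul_zero]
  have hVeq : (fun s => V s i) = fun s => ((M s).updateCol i (c s)).det / (M s).det := by
    ext s
    rw [eq_div_iff (hdet s), ← Matrix.cramer_apply, ← hcr s]
    simp [mul_comm]
  have hM : ∀ i j, DifferentiableAt ℝ (fun s => M s i j) s := by
    intro i j
    simp only [M, Matrix.of_apply]
    exact (differentiableAt_const _).fun_sub ((hK i j).const_mul γ)
  have hdetd : ∀ N : ℝ → Matrix ι ι ℝ, (∀ i j, DifferentiableAt ℝ (fun s => N s i j) s) →
      DifferentiableAt ℝ (fun s => (N s).det) s := by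
    intro N hN
    simp only [Matrix.det_apply]
    refine DifferentiableAt.fun_sum fun σ _ => ?_
    exact (DifferentiableAt.fun_finsetProd fun j _ => hN _ _).const_smul _
  rw [hVeq]
  refine DifferentiableAt.fun_div (hdetd _ fun j k => ?_) (hdetd _ hM) (hdet s)
  simp only [Matrix.updateCol_apply]
  split_ifs
  · exact hc j
  · exact hM j k
/-- Along the softmax gradient flow, the preference of an action whose advantage stays bounded
below by a positive constant diverges to infinity. -/
theorem tendsto_preference_atTop {X A : Type*} [Fintype A] [Nonempty A]
    {θ : ℝ → X → A → ℝ} {adv : ℝ → A → ℝ} {d : ℝ → ℝ} {c m M T : ℝ} {x : X} (hc : 0 < c)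
    (hm : 0 < m) (hd : ∀ s, T ≤ s → c ≤ d s ∧ d s ≤ 1)
    (hθ : ∀ s, T ≤ s → ∀ a,
      HasDerivAt (fun s => θ s x a) (d s * softmaxPol (θ s) x a * adv s a) s)
    (hsum : ∀ s, T ≤ s → ∑ a, softmaxPol (θ s) x a * adv s a = 0)
    (hM : ∀ s, T ≤ s → ∀ a, |adv s a| ≤ M) {o : A} (ho : ∀ s, T ≤ s → m ≤ adv s o) :
    Tendsto (fun s => θ s x o) atTop atTop := by
  have hM0 : 0 < M := by
    have := (le_abs_self _).trans (hM T le_rfl o)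
    linarith [ho T le_rfl]
  have hrate : ∀ s, T ≤ s →
      c * m * softmaxPol (θ s) x o ≤ d s * softmaxPol (θ s) x o * adv s o := by
    intro s hs
    have h1 : c * m ≤ d s * adv s o :=
      mul_le_mul (hd s hs).1 (ho s hs) hm.le (hc.le.trans (hd s hs).1)
    nlinarith [softmaxPol_pos (θ s) x o]
  have hmono : ∀ s t, T ≤ s → s ≤ t → θ s x o ≤ θ t x o := fun s t hs hst =>
    le_of_hasDerivAt_nonneg (fun s hs => hθ s hs o) (fun s hs =>
      le_trans (by have := softmaxPol_pos (θ s) x o; positivity) (hrate s hs)) hs hst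
  by_contra hcon
  obtain ⟨B, hB⟩ : ∃ B, ∀ s, T ≤ s → θ s x o ≤ B := by
    by_contra! hB
    apply hcon
    rw [tendsto_atTop]
    intro B
    obtain ⟨s, hs, hBs⟩ := hB B
    filter_upwards [eventually_ge_atTop s] with t ht
    exact hBs.le.trans (hmono s t hs ht)
  set L := θ T x o with hL
  -- preferences are bounded below
  have hlow : ∃ l, ∀ s, T ≤ s → ∀ b, l ≤ θ s x b := by
    have hb : ∀ b, ∃ l, ∀ s, T ≤ s → l ≤ θ s x b := by
      intro b
      set κ := 2 * M / (c * m) with hκ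
      have hκ0 : 0 < κ := by positivity
      set e := min (θ T x b) L
      refine ⟨e - κ * (B - L), fun s hs => ?_⟩
      have key := le_barrier (T := T) (u := fun s => e - κ * (θ s x o - L))
        (fun s hs => (((hθ s hs o).sub_const L).const_mul κ).const_sub e)
        (fun s hs => hθ s hs b) (by simp [← hL, e]) (by
          intro s hs heq
          have h1 : θ s x b ≤ θ s x o := by
            have h2 := hmono T s le_rfl hs
            have h3 : e ≤ L := min_le_right _ _
            nlinarith [mul_nonneg hκ0.le (sub_nonneg.2 h2)]
          have hfle : softmaxPol (θ s) x b ≤ softmaxPol (θ s) x o := by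
            rw [softmaxPol_eq_mul (θ s) x b o]
            exact mul_le_of_le_one_left (softmaxPol_pos _ _ _).le
              (Real.exp_le_one_iff.2 (sub_nonpos.2 h1))
          have hfo := softmaxPol_pos (θ s) x o
          have hfb := softmaxPol_pos (θ s) x b
          have h2 : κ * (c * m * softmaxPol (θ s) x o) = 2 * M * softmaxPol (θ s) x o := by
            rw [hκ]; field_simp
          have h3 := mul_le_mul_of_nonneg_left (hrate s hs) hκ0.le
          have h4 : |d s * softmaxPol (θ s) x b * adv s b| ≤ 1 * softmaxPol (θ s) x o * M := by
            rw [abs_mul, abs_mul, abs_of_pos hfb,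
              abs_of_pos (hc.trans_le (hd s hs).1)]
            gcongr
            · exact (hd s hs).2
            · exact hM s hs b
          have h5 := neg_abs_le (d s * softmaxPol (θ s) x b * adv s b)
          nlinarith [mul_pos hM0 hfo]) s hs
      have := mul_le_mul_of_nonneg_left (sub_le_sub_right (hB s hs) L) hκ0.le
      linarith
    choose l hl using hb
    refine ⟨-∑ b, |l b|, fun s hs b => le_trans ?_ (hl b s hs)⟩
    have := Finset.single_le_sum (f := fun b => |l b|) (fun b _ => abs_nonneg _) (Finset.mem_univ b)
    linarith [neg_abs_le (l b)]
  obtain ⟨l, hl⟩ := hlow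
  -- the sum of the preferences is conserved, hence they are bounded above
  have hcons : ∀ s, T ≤ s → ∑ b, θ s x b = ∑ b, θ T x b := by
    intro s hs
    have hder : ∀ s, T ≤ s → HasDerivAt (fun s => ∑ b, θ s x b) 0 s := by
      intro s hs
      refine (HasDerivAt.fun_sum fun b _ => hθ s hs b).congr_deriv ?_
      simp only [mul_assoc, ← Finset.mul_sum, hsum s hs, mul_zero]
    exact le_antisymm (ge_of_hasDerivAt_nonpos hder (fun _ _ => le_rfl) le_rfl hs)
      (le_of_hasDerivAt_nonneg hder (fun _ _ => le_rfl) le_rfl hs)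
  set U := l + ∑ b, (θ T x b - l) with hU
  have hup : ∀ s, T ≤ s → ∀ b, θ s x b ≤ U := by
    intro s hs b
    have h1 := Finset.single_le_sum (f := fun b => θ s x b - l)
      (fun b _ => sub_nonneg.2 (hl s hs b)) (Finset.mem_univ b)
    simp only [Finset.sum_sub_distrib, hcons s hs] at h1
    rw [hU, Finset.sum_sub_distrib]
    linarith
  set φ := Real.exp l / ∑ _b : A, Real.exp U with hφ
  have hφ0 : 0 < φ :=
    div_pos (Real.exp_pos _) (Finset.sum_pos (fun _ _ => Real.exp_pos _) Finset.univ_nonempty)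
  have hfφ : ∀ s, T ≤ s → φ ≤ softmaxPol (θ s) x o := by
    intro s hs
    unfold softmaxPol
    refine div_le_div₀ (Real.exp_pos _).le (Real.exp_le_exp.2 (hl s hs o))
      (Finset.sum_pos (fun _ _ => Real.exp_pos _) Finset.univ_nonempty)
      (Finset.sum_le_sum fun b _ => Real.exp_le_exp.2 (hup s hs b))
  have hgrow : ∀ s, T ≤ s → L + c * m * φ * (s - T) ≤ θ s x o := by
    intro s hs
    have := le_of_hasDerivAt_nonneg (T := T) (u := fun s => θ s x o - c * m * φ * (s - T))
      (fun s hs => (hθ s hs o).fun_sub (((hasDerivAt_id s).sub_const T).const_mul (c * m * φ)))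
      (fun s hs => by
        have h1 := mul_le_mul_of_nonneg_left (hfφ s hs) (mul_pos hc hm).le
        linarith [hrate s hs]) le_rfl hs
    simp only [sub_self, mul_zero, sub_zero] at this
    linarith
  have hpos : 0 < c * m * φ := by positivity
  have h1 := hgrow (T + (|B - L| + 1) / (c * m * φ)) (by
    have : 0 ≤ (|B - L| + 1) / (c * m * φ) := by positivity
    linarith)
  have h2 := hB (T + (|B - L| + 1) / (c * m * φ)) (by
    have : 0 ≤ (|B - L| + 1) / (c * m * φ) := by positivity
    linarith)
  rw [add_sub_cancel_left, mul_div_cancel₀ _ hpos.ne'] at h1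
  linarith [le_abs_self (B - L)]

/-- If the action values along a softmax gradient flow converge, then the value of the policy
converges to the largest limiting action value. -/
theorem limit_action_value_le {X A : Type*} [Fintype A] [Nonempty A]
    {θ : ℝ → X → A → ℝ} {Q : ℝ → A → ℝ} {d : ℝ → ℝ} {q : A → ℝ} {v c T : ℝ} {x : X} (hc : 0 < c)
    (hd : ∀ s, T ≤ s → c ≤ d s ∧ d s ≤ 1)
    (hθ : ∀ s, T ≤ s → ∀ a, HasDerivAt (fun s => θ s x a)
      (d s * softmaxPol (θ s) x a * (Q s a - ∑ b, Q s b * softmaxPol (θ s) x b)) s)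
    (hQ : ∀ a, Tendsto (fun s => Q s a) atTop (𝓝 (q a)))
    (hv : Tendsto (fun s => ∑ b, Q s b * softmaxPol (θ s) x b) atTop (𝓝 v)) (a : A) :
    q a ≤ v := by
  by_contra hcon
  obtain ⟨o, ho⟩ := Finite.exists_max q
  have hvo : v < q o := by linarith [ho a]
  set Δ := q o - v with hΔ
  have hΔ0 : 0 < Δ := sub_pos.2 hvo
  set adv : ℝ → A → ℝ := fun s a => Q s a - ∑ b, Q s b * softmaxPol (θ s) x b with hadv
  have hadvlim : ∀ a, Tendsto (fun s => adv s a) atTop (𝓝 (q a - v)) := fun a => (hQ a).sub hv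
  have hsum : ∀ s, ∑ a, softmaxPol (θ s) x a * adv s a = 0 := by
    intro s
    simp only [hadv, mul_sub, Finset.sum_sub_distrib, ← Finset.sum_mul, softmaxPol_sum, one_mul]
    rw [sub_eq_zero]
    exact Finset.sum_congr rfl fun b _ => mul_comm _ _
  set N : ℝ := (Fintype.card A : ℝ) with hN
  have hN0 : 0 < N := by
    rw [hN]; exact_mod_cast Fintype.card_pos
  set ε := Δ / (4 * N) with hε
  have hε0 : 0 < ε := by positivity
  set M := 1 + ∑ a, |q a - v| with hM
  have hM0 : 0 < M := by positivity
  have hev : ∀ᶠ s in atTop, T ≤ s ∧ Δ / 2 ≤ adv s o ∧ (∀ a, |adv s a| ≤ M) ∧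
      (∀ a, q a < v → adv s a ≤ 0) ∧ (∀ a, v < q a → 0 ≤ adv s a) ∧
      (∀ a, q a = v → |adv s a| ≤ ε ∧ adv s a < adv s o) := by
    have h1 : ∀ᶠ s in atTop, Δ / 2 ≤ adv s o :=
      (hadvlim o).eventually (le_mem_nhds (by linarith))
    have h2 : ∀ᶠ s in atTop, ∀ a, |adv s a| ≤ M := by
      rw [eventually_all]
      intro a
      refine (hadvlim a).abs.eventually (ge_mem_nhds ?_)
      have := Finset.single_le_sum (f := fun a => |q a - v|) (fun b _ => abs_nonneg _)
        (Finset.mem_univ a)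
      linarith
    have h3 : ∀ᶠ s in atTop, ∀ a, q a < v → adv s a ≤ 0 := by
      rw [eventually_all]
      intro a
      rw [eventually_imp_distrib_left]
      exact fun h => (hadvlim a).eventually (ge_mem_nhds (by linarith))
    have h4 : ∀ᶠ s in atTop, ∀ a, v < q a → 0 ≤ adv s a := by
      rw [eventually_all]
      intro a
      rw [eventually_imp_distrib_left]
      exact fun h => (hadvlim a).eventually (le_mem_nhds (by linarith))
    have h5 : ∀ᶠ s in atTop, ∀ a, q a = v → |adv s a| ≤ ε ∧ adv s a < adv s o := by
      rw [eventually_all]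
      intro a
      rw [eventually_imp_distrib_left]
      intro h
      refine Eventually.and ?_ ((hadvlim a).eventually_lt (hadvlim o) (by linarith))
      exact (hadvlim a).abs.eventually (ge_mem_nhds (by simpa [h] using hε0))
    filter_upwards [eventually_ge_atTop T, h1, h2, h3, h4, h5] with s a1 a2 a3 a4 a5 a6
    exact ⟨a1, a2, a3, a4, a5, a6⟩
  obtain ⟨T₁, hT₁⟩ := eventually_atTop.1 hev
  have hotop : Tendsto (fun s => θ s x o) atTop atTop :=
    tendsto_preference_atTop (adv := adv) (T := T₁) (m := Δ / 2) hc (by positivity)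
      (fun s hs => hd s (hT₁ s hs).1) (fun s hs => hθ s (hT₁ s hs).1) (fun s _ => hsum s)
      (fun s hs => (hT₁ s hs).2.2.1) fun s hs => (hT₁ s hs).2.1
  have hdpos : ∀ s, T₁ ≤ s → 0 < d s := fun s hs => hc.trans_le (hd s (hT₁ s hs).1).1
  -- actions with negative limiting advantage become negligible relative to `o`
  have hneg : ∀ b, q b < v → ∀ᶠ s in atTop,
      M * softmaxPol (θ s) x b ≤ ε * softmaxPol (θ s) x o := by
    intro b hb
    filter_upwards [eventually_ge_atTop T₁,
      hotop.eventually_ge_atTop (θ T₁ x b - Real.log (ε / M))] with s hs hs2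
    have h1 : θ s x b ≤ θ T₁ x b :=
      ge_of_hasDerivAt_nonpos (fun s hs => hθ s (hT₁ s hs).1 b) (fun s hs =>
        mul_nonpos_of_nonneg_of_nonpos (mul_nonneg (hdpos s hs).le (softmaxPol_pos _ _ _).le)
          ((hT₁ s hs).2.2.2.1 b hb)) le_rfl hs
    have h2 : Real.exp (θ s x b - θ s x o) ≤ ε / M := by
      rw [← Real.le_log_iff_exp_le (by positivity)]
      linarith
    rw [softmaxPol_eq_mul (θ s) x b o, ← mul_assoc]
    refine mul_le_mul_of_nonneg_right ?_ (softmaxPol_pos _ _ _).le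
    rw [le_div_iff₀ hM0] at h2
    linarith
  set S : Finset A := Finset.univ.filter fun b => q b = v ∧ ∀ s, T₁ ≤ s → θ s x o ≤ θ s x b with hS
  -- actions with zero limiting advantage outside `S` eventually have smaller preference than `o`
  have hzero : ∀ b, q b = v → b ∉ S → ∀ᶠ s in atTop,
      softmaxPol (θ s) x b ≤ softmaxPol (θ s) x o := by
    intro b hb hbS
    obtain ⟨s₀, hs₀, hlt⟩ : ∃ s, T₁ ≤ s ∧ θ s x b < θ s x o := by
      by_contra! h
      exact hbS (by simp [hS, hb]; exact h)
    filter_upwards [eventually_ge_atTop s₀] with s hs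
    have key := le_barrier (T := s₀) (fun s hs => hθ s (hT₁ s (hs₀.trans hs)).1 b)
      (fun s hs => hθ s (hT₁ s (hs₀.trans hs)).1 o) hlt.le (by
        intro s hs heq
        have hs' := hs₀.trans hs
        have : softmaxPol (θ s) x b = softmaxPol (θ s) x o := by
          rw [softmaxPol_eq_mul (θ s) x b o, heq, sub_self, Real.exp_zero, one_mul]
        rw [this]
        exact mul_lt_mul_of_pos_left ((hT₁ s hs').2.2.2.2.2 b hb).2
          (mul_pos (hdpos s hs') (softmaxPol_pos _ _ _))) s hs
    rw [softmaxPol_eq_mul (θ s) x b o]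
    exact mul_le_of_le_one_left (softmaxPol_pos _ _ _).le
      (Real.exp_le_one_iff.2 (sub_nonpos.2 key))
  have hoS : o ∉ S := fun h => by
    simp only [hS, Finset.mem_filter] at h
    exact hvo.ne' h.2.1
  have hSneg : ∀ᶠ s in atTop, ∑ b ∈ S, softmaxPol (θ s) x b * adv s b < 0 := by
    have h1 : ∀ᶠ s in atTop, ∀ b, q b < v → M * softmaxPol (θ s) x b ≤ ε * softmaxPol (θ s) x o := by
      rw [eventually_all]
      intro b
      rw [eventually_imp_distrib_left]
      exact hneg b
    have h2 : ∀ᶠ s in atTop, ∀ b, q b = v → b ∉ S → softmaxPol (θ s) x b ≤ softmaxPol (θ s) x o := by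
      rw [eventually_all]
      intro b
      rw [eventually_imp_distrib_left]
      intro h
      rw [eventually_imp_distrib_left]
      exact hzero b h
    filter_upwards [eventually_ge_atTop T₁, h1, h2] with s hs k1 k2
    obtain ⟨-, e1, e2, e3, e4, e5⟩ := hT₁ s hs
    have hfo := softmaxPol_pos (θ s) x o
    have hb : ∀ b ∈ Sᶜ.erase o,
        -(ε * softmaxPol (θ s) x o) ≤ softmaxPol (θ s) x b * adv s b := by
      intro b hb
      have hbS : b ∉ S := by simpa using (Finset.mem_erase.1 hb).2
      have hfb := softmaxPol_pos (θ s) x b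
      have habs := neg_abs_le (adv s b)
      rcases lt_trichotomy (q b) v with h | h | h
      · have := k1 b h
        nlinarith [e2 b]
      · have := k2 b h hbS
        nlinarith [(e5 b h).1, abs_nonneg (adv s b)]
      · nlinarith [e4 b h, mul_nonneg hfb.le (e4 b h), mul_pos hε0 hfo]
    have h3 : -(N * (ε * softmaxPol (θ s) x o)) ≤
        ∑ b ∈ Sᶜ.erase o, softmaxPol (θ s) x b * adv s b := by
      refine le_trans ?_ (Finset.sum_le_sum hb)
      rw [Finset.sum_const, nsmul_eq_mul, mul_neg, neg_le_neg_iff]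
      refine mul_le_mul_of_nonneg_right ?_ (by positivity)
      rw [hN]
      exact_mod_cast Finset.card_le_univ _
    have h4 : N * ε = Δ / 4 := by rw [hε]; field_simp
    have h5 := Finset.add_sum_erase Sᶜ (fun b => softmaxPol (θ s) x b * adv s b)
      (Finset.mem_compl.2 hoS)
    have h6 := Finset.sum_add_sum_compl S (fun b => softmaxPol (θ s) x b * adv s b)
    rw [hsum s] at h6
    rw [← mul_assoc, h4] at h3
    nlinarith [mul_le_mul_of_nonneg_left e1 hfo.le, mul_pos hΔ0 hfo]
  obtain ⟨T₂, hT₂⟩ := eventually_atTop.1 (hSneg.and (eventually_ge_atTop T₁))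
  rcases S.eq_empty_or_nonempty with hSe | ⟨b, hbS⟩
  · have := (hT₂ T₂ le_rfl).1
    simp [hSe] at this
  · have hanti : ∀ s, T₂ ≤ s → ∑ b ∈ S, θ s x b ≤ ∑ b ∈ S, θ T₂ x b := fun s hs =>
      ge_of_hasDerivAt_nonpos (u := fun s => ∑ b ∈ S, θ s x b)
        (fun s hs => HasDerivAt.fun_sum fun b _ => hθ s (hT₁ s (hT₂ s hs).2).1 b)
        (fun s hs => by
          simp only [mul_assoc, ← Finset.mul_sum]
          exact mul_nonpos_of_nonneg_of_nonpos (hdpos s (hT₂ s hs).2).le (hT₂ s hs).1.le)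
        le_rfl hs
    obtain ⟨s, hs0, hs1, hs2⟩ := ((hotop.eventually_ge_atTop (|∑ b ∈ S, θ T₂ x b| + 1)).and
      ((eventually_ge_atTop T₂).and (eventually_ge_atTop T₁))).exists
    have hge : ∀ b ∈ S, |∑ b ∈ S, θ T₂ x b| + 1 ≤ θ s x b := fun b hb =>
      hs0.trans ((Finset.mem_filter.1 hb).2.2 s hs2)
    have h1 : θ s x b ≤ ∑ b ∈ S, θ s x b :=
      Finset.single_le_sum (f := fun b => θ s x b)
        (fun b hb => le_trans (by positivity) (hge b hb)) hbS
    linarith [hge b hbS, hanti s hs1, le_abs_self (∑ b ∈ S, θ T₂ x b)]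
theorem family_abs_le_barrier {ι : Type*} [Finite ι] {u u' : ι → ℝ → ℝ} {B B' : ℝ → ℝ} {T : ℝ}
    (hu : ∀ i, ∀ s, T ≤ s → HasDerivAt (u i) (u' i s) s)
    (hB : ∀ s, T ≤ s → HasDerivAt B (B' s) s)
    (h0 : ∀ i, |u i T| ≤ B T)
    (h : ∀ s, T ≤ s → (∀ j, |u j s| ≤ B s) → ∀ i,
      (u i s = B s → u' i s < B' s) ∧ (-u i s = B s → -u' i s < B' s)) :
    ∀ s, T ≤ s → ∀ i, |u i s| ≤ B s := by
  have key := family_le_barrier (ι := ι ⊕ ι) (u := Sum.elim u fun i s => -u i s)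
    (u' := Sum.elim u' fun i s => -u' i s) (B := B) (B' := B') (T := T)
    (by rintro (i | i) s hs
        · exact hu i s hs
        · exact (hu i s hs).fun_neg) hB
    (by rintro (i | i)
        · exact (le_abs_self _).trans (h0 i)
        · exact (neg_le_abs _).trans (h0 i))
    (by
      intro s hs hle
      have habs : ∀ j, |u j s| ≤ B s := fun j => abs_le'.2 ⟨hle (.inl j), hle (.inr j)⟩
      rintro (i | i) heq
      · exact (h s hs habs i).1 heq
      · exact (h s hs habs i).2 heq)
  exact fun s hs i => abs_le'.2 ⟨key s hs (.inl i), key s hs (.inr i)⟩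

theorem kpow_nonneg {S : Type*} [Fintype S] [DecidableEq S] {K : S → S → ℝ}
    (hK : ∀ ξ ξ', 0 ≤ K ξ ξ') (n : ℕ) (ξ ξ' : S) : 0 ≤ kpow K n ξ ξ' := by
  induction n generalizing ξ with
  | zero => unfold kpow; split_ifs <;> norm_num
  | succ n ih =>
    unfold kpow
    exact Finset.sum_nonneg fun y _ => mul_nonneg (hK _ _) (ih y)

theorem pow_mul_kpow_le {S : Type*} [Fintype S] [DecidableEq S] {K K' : S → S → ℝ} {ε : ℝ}
    (hε : 0 ≤ ε) (hK' : ∀ ξ ξ', 0 ≤ K' ξ ξ') (h : ∀ ξ ξ', ε * K' ξ ξ' ≤ K ξ ξ') (n : ℕ)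
    (ξ ξ' : S) : ε ^ n * kpow K' n ξ ξ' ≤ kpow K n ξ ξ' := by
  induction n generalizing ξ with
  | zero => simp [kpow]
  | succ n ih =>
    unfold kpow
    rw [Finset.mul_sum]
    refine Finset.sum_le_sum fun y _ => ?_
    calc ε ^ (n + 1) * (K' ξ y * kpow K' n y ξ') = (ε * K' ξ y) * (ε ^ n * kpow K' n y ξ') := by
          ring
      _ ≤ K ξ y * kpow K n y ξ' :=
          mul_le_mul (h ξ y) (ih y) (mul_nonneg (pow_nonneg hε n) (kpow_nonneg hK' n y ξ'))
            ((mul_nonneg hε (hK' ξ y)).trans (h ξ y))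

theorem IsStationaryDist.eq_sum_kpow {S : Type*} [Fintype S] [DecidableEq S] {K : S → S → ℝ}
    {d : S → ℝ} (hd : IsStationaryDist K d) (n : ℕ) (ξ' : S) :
    d ξ' = ∑ ξ, d ξ * kpow K n ξ ξ' := by
  induction n with
  | zero => simp [kpow]
  | succ n ih =>
    rw [ih]
    simp only [kpow, Finset.mul_sum]
    rw [Finset.sum_comm]
    refine Finset.sum_congr rfl fun y _ => ?_
    rw [hd.2.2 y, Finset.sum_mul]
    exact Finset.sum_congr rfl fun ξ _ => by ring

theorem exists_le_stationary_explorePol {X A : Type*} [Fintype X] [Fintype A] [Nonempty X]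
    [Nonempty A] [DecidableEq X] [DecidableEq A] {p : X → A → X → ℝ}
    (hp0 : ∀ x a x', 0 ≤ p x a x') {pista : (X → A → ℝ) → X × A → ℝ}
    (hpi : ∀ (η : ℝ) (θ : X → A → ℝ), 0 ≤ η → η < 1 →
      IsStationaryDist (criticKer p (explorePol η θ)) (pista (explorePol η θ)))
    (hergC : ∀ (η : ℝ) (θ : X → A → ℝ), 0 ≤ η → η < 1 → ∃ n, 0 < n ∧
      ∀ ξ ξ' : X × A, 0 < kpow (criticKer p (explorePol η θ)) n ξ ξ') :
    ∃ c : ℝ, 0 < c ∧ ∃ n : ℕ, ∀ (η : ℝ) (θ : X → A → ℝ), 0 ≤ η → η < 1 →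
      ∀ ξ, c * η ^ n ≤ pista (explorePol η θ) ξ := by
  obtain ⟨n, -, hn⟩ := hergC 0 0 le_rfl zero_lt_one
  obtain ⟨⟨ξ₁, ξ₂⟩, hmin⟩ := Finite.exists_min fun ξ : (X × A) × (X × A) =>
    kpow (criticKer p (explorePol 0 0)) n ξ.1 ξ.2
  refine ⟨_, hn ξ₁ ξ₂, n, fun η θ hη0 hη1 ξ' => ?_⟩
  have hst := hpi η θ hη0 hη1
  have hunif : ∀ (x : X) (a : A), explorePol 0 0 x a = 1 / (Fintype.card A : ℝ) := by
    intro x a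
    simp [explorePol, softmaxPol]
  have hle := pow_mul_kpow_le (K := criticKer p (explorePol η θ))
    (K' := criticKer p (explorePol 0 0)) hη0
    (fun ξ ξ' => by
      simp only [criticKer, hunif]
      exact mul_nonneg (hp0 _ _ _) (by positivity))
    (fun ξ ξ' => by
      simp only [criticKer, hunif]
      have h1 : η * (1 / (Fintype.card A : ℝ)) ≤ explorePol η θ ξ'.1 ξ'.2 := by
        unfold explorePol
        have := mul_nonneg (sub_nonneg.2 hη1.le) (softmaxPol_pos θ ξ'.1 ξ'.2).le
        rw [mul_one_div]
        linarith
      nlinarith [mul_le_mul_of_nonneg_left h1 (hp0 ξ.1 ξ.2 ξ'.1)]) n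
  rw [hst.eq_sum_kpow n ξ']
  calc _ = ∑ ξ, pista (explorePol η θ) ξ * (kpow (criticKer p (explorePol 0 0)) n ξ₁ ξ₂ * η ^ n) := by
        rw [← Finset.sum_mul, hst.2.1, one_mul]
    _ ≤ _ := by
        refine Finset.sum_le_sum fun ξ _ => mul_le_mul_of_nonneg_left ?_ (hst.1 ξ)
        refine le_trans ?_ (hle ξ ξ')
        rw [mul_comm]
        exact mul_le_mul_of_nonneg_left (hmin (ξ, ξ')) (pow_nonneg hη0 n)

/-- A convex combination of numbers bounded by `B` is bounded by `B`. -/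
theorem abs_sum_mul_le {ι : Type*} [Fintype ι] {w u : ι → ℝ} {B : ℝ} (hw : ∀ i, 0 ≤ w i)
    (hw1 : ∑ i, w i = 1) (hu : ∀ i, |u i| ≤ B) : |∑ i, w i * u i| ≤ B := by
  calc |∑ i, w i * u i| ≤ ∑ i, |w i * u i| := Finset.abs_sum_le_sum_abs _ _
    _ ≤ ∑ i, w i * B := Finset.sum_le_sum fun i _ => by
        rw [abs_mul, abs_of_nonneg (hw i)]
        exact mul_le_mul_of_nonneg_left (hu i) (hw i)
    _ = B := by rw [← Finset.sum_mul, hw1, one_mul]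

theorem isPolicy_explorePol {X A : Type*} [Fintype A] [Nonempty A] {η : ℝ} (h0 : 0 ≤ η)
    (h1 : η ≤ 1) (θ : X → A → ℝ) : IsPolicy (explorePol η θ) := by
  refine ⟨fun x a => ?_, fun x => ?_⟩
  · unfold explorePol
    have := mul_nonneg (sub_nonneg.2 h1) (softmaxPol_pos θ x a).le
    positivity
  · simp only [explorePol, Finset.sum_add_distrib, ← Finset.mul_sum, softmaxPol_sum]
    rw [Finset.sum_const, nsmul_eq_mul, Finset.card_univ]
    have : (Fintype.card A : ℝ) ≠ 0 := by exact_mod_cast Fintype.card_ne_zero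
    field_simp
    ring

/-- The state-to-state transition kernel induced by a policy. -/
def policyKer {X A : Type*} [Fintype A] (p : X → A → X → ℝ) (f : X → A → ℝ) (x x' : X) : ℝ :=
  ∑ a, f x a * p x a x'

/-- The Bellman equation for the action-value function `q` of a policy `f`. -/
def IsActionValue {X A : Type*} [Fintype X] [Fintype A] (p : X → A → X → ℝ) (r : X → A → ℝ) (γ : ℝ)
    (f q : X → A → ℝ) : Prop :=
  ∀ x a, q x a = r x a + γ * ∑ x', p x a x' * ∑ a', f x' a' * q x' a'

section Bellman

variable {X A : Type*} [Fintype A] {p : X → A → X → ℝ} {r : X → A → ℝ} {γ : ℝ}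

theorem policyKer_nonneg (hp0 : ∀ x a x', 0 ≤ p x a x') {f : X → A → ℝ} (hf : IsPolicy f)
    (x x' : X) : 0 ≤ policyKer p f x x' :=
  Finset.sum_nonneg fun a _ => mul_nonneg (hf.1 x a) (hp0 x a x')

variable [Fintype X]

theorem sum_policyKer_mul {f : X → A → ℝ} (u : X → ℝ) (x : X) :
    ∑ x', policyKer p f x x' * u x' = ∑ a, f x a * ∑ x', p x a x' * u x' := by
  simp only [policyKer, Finset.sum_mul, Finset.mul_sum]
  rw [Finset.sum_comm]
  simp only [mul_assoc]

theorem policyKer_sum (hp1 : ∀ x a, ∑ x', p x a x' = 1) {f : X → A → ℝ} (hf : IsPolicy f) (x : X) :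
    ∑ x', policyKer p f x x' = 1 := by
  have := sum_policyKer_mul (p := p) (f := f) (fun _ => 1) x
  simpa [hp1, hf.2] using this

theorem IsActionValue.state_eq {f q : X → A → ℝ} (hq : IsActionValue p r γ f q) (x : X) :
    ∑ a, f x a * q x a
      = ∑ a, f x a * r x a + γ * ∑ x', policyKer p f x x' * ∑ a, f x' a * q x' a := by
  rw [sum_policyKer_mul, Finset.mul_sum, ← Finset.sum_add_distrib]
  refine Finset.sum_congr rfl fun a _ => ?_
  rw [hq x a]
  ring

theorem IsActionValue.abs_state_le (hp0 : ∀ x a x', 0 ≤ p x a x') (hp1 : ∀ x a, ∑ x', p x a x' = 1)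
    (hr : ∀ x a, 0 ≤ r x a ∧ r x a ≤ 1) (hγ0 : 0 ≤ γ) (hγ1 : γ < 1) {f q : X → A → ℝ}
    (hf : IsPolicy f) (hq : IsActionValue p r γ f q) (x : X) :
    |∑ a, f x a * q x a| ≤ 1 / (1 - γ) :=
  abs_le_div_of_eq_add_discounted hγ0 hγ1 (policyKer_nonneg hp0 hf) (policyKer_sum hp1 hf)
    (u := fun x => ∑ a, f x a * q x a) hq.state_eq
    (fun x => abs_sum_mul_le (hf.1 x) (hf.2 x) fun a => abs_le.2 ⟨by linarith [hr x a], (hr x a).2⟩) x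

theorem IsActionValue.abs_le (hp0 : ∀ x a x', 0 ≤ p x a x') (hp1 : ∀ x a, ∑ x', p x a x' = 1)
    (hr : ∀ x a, 0 ≤ r x a ∧ r x a ≤ 1) (hγ0 : 0 ≤ γ) (hγ1 : γ < 1) {f q : X → A → ℝ}
    (hf : IsPolicy f) (hq : IsActionValue p r γ f q) (x : X) (a : A) :
    |q x a| ≤ 1 / (1 - γ) := by
  have h1 := abs_sum_mul_le (hp0 x a) (hp1 x a)
    (hq.abs_state_le hp0 hp1 hr hγ0 hγ1 hf)
  rw [hq x a]
  have h2 : 1 / (1 - γ) = 1 + γ * (1 / (1 - γ)) := by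
    have : (1 - γ) ≠ 0 := by linarith
    field_simp
    ring
  rw [h2]
  refine (abs_add_le _ _).trans (add_le_add ?_ ?_)
  · rw [abs_of_nonneg (hr x a).1]; exact (hr x a).2
  · rw [abs_mul, abs_of_nonneg hγ0]
    exact mul_le_mul_of_nonneg_left h1 hγ0

/-- Derivative of the value functions along a differentiable path of policies. -/
theorem exists_hasDerivAt_value (hp0 : ∀ x a x', 0 ≤ p x a x') (hp1 : ∀ x a, ∑ x', p x a x' = 1)
    (hγ0 : 0 ≤ γ) (hγ1 : γ < 1) {f q : ℝ → X → A → ℝ} (hf : ∀ s, IsPolicy (f s))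
    (hq : ∀ s, IsActionValue p r γ (f s) (q s)) {s : ℝ} {f' : X → A → ℝ}
    (hf' : ∀ x a, HasDerivAt (fun s => f s x a) (f' x a) s) :
    ∃ D : X → ℝ, (∀ x, HasDerivAt (fun s => ∑ a, f s x a * q s x a) (D x) s) ∧
      (∀ x a, HasDerivAt (fun s => q s x a) (γ * ∑ x', p x a x' * D x') s) ∧
      ∀ x, D x = ∑ a, f' x a * q s x a + γ * ∑ x', policyKer p (f s) x x' * D x' := by
  have hdiff : ∀ x, DifferentiableAt ℝ (fun s => ∑ a, f s x a * q s x a) s := fun x =>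
    differentiableAt_of_discounted hγ0 hγ1 (K := fun s => policyKer p (f s))
      (c := fun s x => ∑ a, f s x a * r x a) (V := fun s x => ∑ a, f s x a * q s x a)
      (fun s => policyKer_nonneg hp0 (hf s)) (fun s => policyKer_sum hp1 (hf s))
      (fun s => (hq s).state_eq)
      (fun x x' => DifferentiableAt.fun_sum fun a _ => (hf' x a).differentiableAt.mul_const _)
      (fun x => DifferentiableAt.fun_sum fun a _ => (hf' x a).differentiableAt.mul_const _) x
  choose D hD using fun x => (⟨_, (hdiff x).hasDerivAt⟩ :
    ∃ D, HasDerivAt (fun s => ∑ a, f s x a * q s x a) D s)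
  have hqd : ∀ x a, HasDerivAt (fun s => q s x a) (γ * ∑ x', p x a x' * D x') s := by
    intro x a
    have : (fun s => q s x a)
        = fun s => r x a + γ * ∑ x', p x a x' * ∑ a', f s x' a' * q s x' a' := by
      ext s
      exact hq s x a
    rw [this]
    exact ((HasDerivAt.fun_sum fun x' _ => (hD x').const_mul (p x a x')).const_mul γ).const_add _
  refine ⟨D, hD, hqd, fun x => ?_⟩
  have h1 : HasDerivAt (fun s => ∑ a, f s x a * q s x a)
      (∑ a, (f' x a * q s x a + f s x a * (γ * ∑ x', p x a x' * D x'))) s :=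
    HasDerivAt.fun_sum fun a _ => (hf' x a).fun_mul (hqd x a)
  rw [(hD x).unique h1, sum_policyKer_mul, Finset.sum_add_distrib, Finset.mul_sum]
  congr 1
  exact Finset.sum_congr rfl fun a _ => by ring

/-- The temporal difference under the exploration policy is close to the negative error. -/
theorem abs_td_add_error_le [Nonempty A] (hp0 : ∀ x a x', 0 ≤ p x a x')
    (hp1 : ∀ x a, ∑ x', p x a x' = 1) (hγ0 : 0 ≤ γ) {θ q Q : X → A → ℝ} {η B R : ℝ}
    (hη0 : 0 ≤ η) (hη1 : η ≤ 1) (hq : IsActionValue p r γ (softmaxPol θ) q)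
    (hR : ∀ x a, |q x a| ≤ R) (hB : ∀ x a, |Q x a - q x a| ≤ B) (x : X) (a : A) :
    |r x a + γ * (∑ z, ∑ a', Q z a' * explorePol η θ z a' * p x a z) - Q x a + (Q x a - q x a)|
      ≤ γ * (B + 2 * η * R) := by
  have hg := isPolicy_explorePol hη0 hη1 θ
  have hf := isPolicy_softmaxPol θ
  have hz : ∀ z, |∑ a', explorePol η θ z a' * (Q z a' - q z a')
      + (η * ∑ a', 1 / (Fintype.card A : ℝ) * q z a' - η * ∑ a', softmaxPol θ z a' * q z a')|
      ≤ B + 2 * η * R := by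
    intro z
    have h1 := abs_sum_mul_le (hg.1 z) (hg.2 z) (hB z)
    have h2 := abs_sum_mul_le (w := fun _ : A => 1 / (Fintype.card A : ℝ)) (fun _ => by positivity)
      (by simp) (hR z)
    have h3 := abs_sum_mul_le (hf.1 z) (hf.2 z) (hR z)
    refine (abs_add_le _ _).trans (add_le_add h1 ?_)
    refine (abs_sub _ _).trans ?_
    rw [abs_mul, abs_mul, abs_of_nonneg hη0]
    nlinarith
  have heq : r x a + γ * (∑ z, ∑ a', Q z a' * explorePol η θ z a' * p x a z) - Q x a
      + (Q x a - q x a) = γ * ∑ z, p x a z * (∑ a', explorePol η θ z a' * (Q z a' - q z a')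
      + (η * ∑ a', 1 / (Fintype.card A : ℝ) * q z a' - η * ∑ a', softmaxPol θ z a' * q z a')) := by
    have h1 : ∀ z, ∑ a', explorePol η θ z a' * (Q z a' - q z a')
      + (η * ∑ a', 1 / (Fintype.card A : ℝ) * q z a' - η * ∑ a', softmaxPol θ z a' * q z a')
        = ∑ a', Q z a' * explorePol η θ z a' - ∑ a', softmaxPol θ z a' * q z a' := by
      intro z
      simp only [Finset.mul_sum, ← Finset.sum_sub_distrib, ← Finset.sum_add_distrib]
      refine Finset.sum_congr rfl fun a' _ => ?_
      unfold explorePol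
      ring
    simp only [h1]
    simp only [mul_sub, Finset.sum_sub_distrib]
    have h2 : ∑ z, ∑ a', Q z a' * explorePol η θ z a' * p x a z
        = ∑ z, p x a z * ∑ a', Q z a' * explorePol η θ z a' := by
      refine Finset.sum_congr rfl fun z _ => ?_
      rw [Finset.mul_sum]
      exact Finset.sum_congr rfl fun a' _ => by ring
    rw [h2]
    have := hq x a
    linarith
  rw [heq, abs_mul, abs_of_nonneg hγ0]
  exact mul_le_mul_of_nonneg_left (abs_sum_mul_le (hp0 x a) (hp1 x a) hz) hγ0

/-- Values change at most proportionally to the preferences. -/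
theorem abs_value_deriv_le [Nonempty A] (hp0 : ∀ x a x', 0 ≤ p x a x')
    (hp1 : ∀ x a, ∑ x', p x a x' = 1) (hγ0 : 0 ≤ γ) (hγ1 : γ < 1) {f q θ' : X → A → ℝ}
    {D : X → ℝ} {b R : ℝ} (hf : IsPolicy f) (hR : ∀ x a, |q x a| ≤ R) (hb : ∀ x a, |θ' x a| ≤ b)
    (hD : ∀ x, D x = ∑ a, f x a * (θ' x a - ∑ a', f x a' * θ' x a') * q x a
      + γ * ∑ x', policyKer p f x x' * D x') (x : X) : |D x| ≤ 2 * b * R / (1 - γ) := by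
  refine abs_le_div_of_eq_add_discounted hγ0 hγ1 (policyKer_nonneg hp0 hf) (policyKer_sum hp1 hf)
    hD (fun x => ?_) x
  simp only [mul_assoc (f x _)]
  refine abs_sum_mul_le (hf.1 x) (hf.2 x) fun a => ?_
  rw [abs_mul]
  have h1 : |θ' x a - ∑ a', f x a' * θ' x a'| ≤ 2 * b := by
    have := abs_sum_mul_le (hf.1 x) (hf.2 x) (hb x)
    have h2 := abs_sub (θ' x a) (∑ a', f x a' * θ' x a')
    linarith [hb x a]
  exact mul_le_mul h1 (hR x a) (abs_nonneg _) ((abs_nonneg _).trans h1)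

theorem tendsto_exp_mul_inv_one_add_sq_pow (n : ℕ) :
    Tendsto (fun s : ℝ => Real.exp s * ((1 + s ^ 2)⁻¹) ^ n) atTop atTop := by
  have h1 := (Real.tendsto_exp_div_pow_atTop (2 * n)).const_mul_atTop
    (show (0 : ℝ) < (2 ^ n)⁻¹ by positivity)
  refine tendsto_atTop_mono' _ ?_ h1
  filter_upwards [eventually_ge_atTop 1] with s hs
  have h2 : (1 + s ^ 2) ^ n ≤ 2 ^ n * s ^ (2 * n) := by
    rw [pow_mul, ← mul_pow]
    gcongr
    nlinarith
  rw [inv_pow]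
  have h3 : ((2 : ℝ) ^ n * s ^ (2 * n))⁻¹ ≤ ((1 + s ^ 2) ^ n)⁻¹ := by
    gcongr
  calc (2 ^ n)⁻¹ * (Real.exp s / s ^ (2 * n)) = Real.exp s * (2 ^ n * s ^ (2 * n))⁻¹ := by
        rw [mul_inv]; ring
    _ ≤ _ := mul_le_mul_of_nonneg_left h3 (Real.exp_pos s).le

theorem hasDerivAt_mul_inv_one_add_sq (K s : ℝ) :
    HasDerivAt (fun s : ℝ => K * (1 + s ^ 2)⁻¹) (-(K * (2 * s / (1 + s ^ 2) ^ 2))) s := by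
  have h : HasDerivAt (fun s : ℝ => 1 + s ^ 2) (2 * s) s := by
    simpa using (hasDerivAt_pow 2 s).const_add 1
  refine ((h.fun_inv (by positivity)).const_mul K).congr_deriv ?_
  ring

/-- In logarithmic time, the critic tracks the action values of the actor up to the exploration
rate. -/
theorem exists_critic_error_le [Nonempty A] (hp0 : ∀ x a x', 0 ≤ p x a x')
    (hp1 : ∀ x a, ∑ x', p x a x' = 1) (hr : ∀ x a, 0 ≤ r x a ∧ r x a ≤ 1) (hγ0 : 0 ≤ γ)
    (hγ1 : γ < 1) {α c : ℝ} (hα : 0 < α) (hc : 0 < c) {n : ℕ} {θ q Q w σ : ℝ → X → A → ℝ}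
    (hq : ∀ s, IsActionValue p r γ (softmaxPol (θ s)) (q s))
    (hw : ∀ s, 1 ≤ s → ∀ x a, c * ((1 + s ^ 2)⁻¹) ^ n ≤ w s x a)
    (hσ : ∀ s x a, 0 ≤ σ s x a ∧ σ s x a ≤ 1)
    (hQ : ∀ s, 1 ≤ s → ∀ x a, HasDerivAt (fun s => Q s x a)
      (Real.exp s * α * w s x a * (r x a + γ * (∑ z, ∑ a',
        Q s z a' * explorePol (1 + s ^ 2)⁻¹ (θ s) z a' * p x a z) - Q s x a)) s)
    (hθ : ∀ s, 1 ≤ s → ∀ x a, HasDerivAt (fun s => θ s x a)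
      (σ s x a * (Q s x a - ∑ a', Q s x a' * softmaxPol (θ s) x a')) s) :
    ∃ K T : ℝ, 0 < K ∧ 1 ≤ T ∧ ∀ s, T ≤ s → ∀ x a, |Q s x a - q s x a| ≤ K * (1 + s ^ 2)⁻¹ := by
  have hγ' : 0 < 1 - γ := sub_pos.2 hγ1
  set R := 1 / (1 - γ) with hRdef
  have hR1 : 1 ≤ R := by rw [hRdef, le_div_iff₀ hγ']; linarith
  have hRγ : R * (1 - γ) = 1 := by rw [hRdef]; field_simp
  have hqR : ∀ s x a, |q s x a| ≤ R := fun s =>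
    (hq s).abs_le hp0 hp1 hr hγ0 hγ1 (isPolicy_softmaxPol _)
  set L := 4 * (1 + R) * R ^ 2 + 1 with hL
  have hL0 : 0 < L := by positivity
  obtain ⟨T, hT⟩ := eventually_atTop.1 (((tendsto_exp_mul_inv_one_add_sq_pow (n + 1)).const_mul_atTop
    (show 0 < α * c * (1 - γ) / 2 by positivity)).eventually_gt_atTop L |>.and
    (eventually_ge_atTop 1))
  have hT1 : 1 ≤ T := (hT T le_rfl).2
  set K := 1 + 4 * R ^ 2 + (1 + T ^ 2) * ∑ x, ∑ a, |Q T x a - q T x a| with hK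
  have hS0 : 0 ≤ (1 + T ^ 2) * ∑ x, ∑ a, |Q T x a - q T x a| := by positivity
  have hKR : 4 * R ^ 2 ≤ K := by linarith
  have hK1 : 1 ≤ K := by
    have : 0 ≤ 4 * R ^ 2 := by positivity
    linarith
  refine ⟨K, T, by linarith, hT1, ?_⟩
  -- derivative of the action values
  have hθ1 : ∀ s, ∃ D : X → A → ℝ, 1 ≤ s →
      (∀ x a, HasDerivAt (fun s => q s x a) (D x a) s) ∧
      ∀ B, (∀ x a, |Q s x a - q s x a| ≤ B) → ∀ x a, |D x a| ≤ 4 * (B + R) * R ^ 2 := by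
    intro s
    by_cases hs : 1 ≤ s
    · set θ' : X → A → ℝ := fun x a =>
        σ s x a * (Q s x a - ∑ a', Q s x a' * softmaxPol (θ s) x a') with hθ'
      obtain ⟨D, -, hD2, hD3⟩ := exists_hasDerivAt_value hp0 hp1 hγ0 hγ1
        (fun s => isPolicy_softmaxPol (θ s)) hq (fun x a => hasDerivAt_softmaxPol (hθ s hs x) a)
      refine ⟨_, fun _ => ⟨hD2, fun B hB x a => ?_⟩⟩
      have hQB : ∀ x a, |Q s x a| ≤ B + R := by
        intro x a
        have := abs_add_le (Q s x a - q s x a) (q s x a)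
        rw [sub_add_cancel] at this
        linarith [hB x a, hqR s x a]
      have hθb : ∀ x a, |θ' x a| ≤ 2 * (B + R) := by
        intro x a
        have h1 := abs_sum_mul_le ((isPolicy_softmaxPol (θ s)).1 x)
          ((isPolicy_softmaxPol (θ s)).2 x) (hQB x)
        have h2 := abs_sub (Q s x a) (∑ a', softmaxPol (θ s) x a' * Q s x a')
        simp only [hθ', abs_mul, abs_of_nonneg (hσ s x a).1]
        simp only [mul_comm (Q s x _)]
        refine (mul_le_of_le_one_left (abs_nonneg _) (hσ s x a).2).trans ?_
        linarith [hQB x a]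
      have hDb := abs_value_deriv_le hp0 hp1 hγ0 hγ1 (isPolicy_softmaxPol (θ s)) (hqR s) hθb hD3
      rw [abs_mul, abs_of_nonneg hγ0]
      refine (mul_le_of_le_one_left (abs_nonneg _) hγ1.le).trans ?_
      refine (abs_sum_mul_le (hp0 x a) (hp1 x a) hDb).trans (le_of_eq ?_)
      rw [hRdef]
      ring
    · exact ⟨fun _ _ => 0, fun h => absurd h hs⟩
  choose D hD using hθ1
  have key := family_abs_le_barrier (ι := X × A) (T := T) (u := fun ξ s => Q s ξ.1 ξ.2 - q s ξ.1 ξ.2)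
    (B := fun s => K * (1 + s ^ 2)⁻¹)
    (fun ξ s hs => (hQ s (hT1.trans hs) ξ.1 ξ.2).fun_sub ((hD s (hT1.trans hs)).1 ξ.1 ξ.2))
    (fun s _ => hasDerivAt_mul_inv_one_add_sq K s)
    (fun ξ => by
      rw [← div_eq_mul_inv, le_div_iff₀ (by positivity), mul_comm]
      have h1 : |Q T ξ.1 ξ.2 - q T ξ.1 ξ.2| ≤ ∑ x, ∑ a, |Q T x a - q T x a| := by
        refine le_trans ?_ (Finset.single_le_sum (f := fun x => ∑ a, |Q T x a - q T x a|)
          (fun x _ => Finset.sum_nonneg fun a _ => abs_nonneg _) (Finset.mem_univ ξ.1))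
        exact Finset.single_le_sum (f := fun a => |Q T ξ.1 a - q T ξ.1 a|)
          (fun a _ => abs_nonneg _) (Finset.mem_univ ξ.2)
      have h2 := mul_le_mul_of_nonneg_left h1 (show 0 ≤ 1 + T ^ 2 by positivity)
      nlinarith [sq_nonneg R])
    (by
      intro s hs hB ξ
      obtain ⟨hTs, hs1⟩ := hT s hs
      set η : ℝ := (1 + s ^ 2)⁻¹ with hη
      have hη0 : 0 < η := by positivity
      have hη1 : η ≤ 1 := inv_le_one_of_one_le₀ (by nlinarith)
      have hB' : ∀ x a, |Q s x a - q s x a| ≤ K * η := fun x a => hB (x, a)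
      have htd := abs_td_add_error_le hp0 hp1 hγ0 hη0.le hη1 (hq s) (hqR s) hB' ξ.1 ξ.2
      have hDb := (hD s hs1).2 _ hB' ξ.1 ξ.2
      set e := Q s ξ.1 ξ.2 - q s ξ.1 ξ.2 with he
      set td := r ξ.1 ξ.2 + γ * (∑ z, ∑ a', Q s z a' * explorePol η (θ s) z a' * p ξ.1 ξ.2 z)
        - Q s ξ.1 ξ.2 with htddef
      -- the temporal difference pulls a maximal error back
      have hpull : γ * (K * η + 2 * η * R) ≤ K * η - (1 - γ) / 2 * K * η := by
        have h1 : 2 * R ≤ (1 - γ) / 2 * K := by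
          have := mul_le_mul_of_nonneg_left hKR (show 0 ≤ (1 - γ) / 2 by positivity)
          nlinarith
        nlinarith [mul_nonneg hη0.le (sub_nonneg.2 h1), mul_nonneg hη0.le
          (mul_nonneg hγ'.le (show 0 ≤ R by linarith))]
      have hstrong : L * K < Real.exp s * α * w s ξ.1 ξ.2 * ((1 - γ) / 2 * K * η) := by
        have h1 : L * K < α * c * (1 - γ) / 2 * (Real.exp s * η ^ (n + 1)) * K :=
          mul_lt_mul_of_pos_right hTs (by linarith)
        refine h1.trans_le ?_
        have h2 := mul_le_mul_of_nonneg_left (hw s hs1 ξ.1 ξ.2)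
          (show 0 ≤ Real.exp s * α * ((1 - γ) / 2 * K * η) by positivity)
        rw [pow_succ]
        linarith
      have hDK : 4 * (K * η + R) * R ^ 2 + K ≤ L * K := by
        have h1 : K * η + R ≤ (1 + R) * K := by
          have h2 : K * η ≤ K := mul_le_of_le_one_right (by linarith) hη1
          have h3 : R ≤ R * K := le_mul_of_one_le_right (by linarith) hK1
          linarith
        have := mul_le_mul_of_nonneg_right h1 (show 0 ≤ 4 * R ^ 2 by positivity)
        rw [hL]
        linarith
      have hBd : K * (2 * s / (1 + s ^ 2) ^ 2) ≤ K := by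
        refine mul_le_of_le_one_right (by linarith) ?_
        rw [div_le_one (by positivity)]
        nlinarith [sq_nonneg (s - 1), sq_nonneg (s ^ 2)]
      have hw0 : 0 ≤ Real.exp s * α * w s ξ.1 ξ.2 :=
        mul_nonneg (by positivity) (le_trans (by positivity) (hw s hs1 ξ.1 ξ.2))
      rw [abs_le'] at htd hDb
      constructor
      · intro heq
        have h1 : td ≤ -((1 - γ) / 2 * K * η) := by linarith [htd.1]
        have h2 := mul_le_mul_of_nonneg_left h1 hw0
        linarith [hDb.2]
      · intro heq
        have h1 : (1 - γ) / 2 * K * η ≤ td := by linarith [htd.2]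
        have h2 := mul_le_mul_of_nonneg_left h1 hw0
        linarith [hDb.1])
  exact fun s hs x a => key s hs (x, a)
/-- Lower bound on the instantaneous improvement of a softmax policy in one state, for a gradient
built from inexact action values. -/
theorem local_improvement_ge {A : Type*} [Fintype A] {f q Q : A → ℝ} {d c E : ℝ}
    (hf0 : ∀ a, 0 ≤ f a) (hf1 : ∑ a, f a = 1) (hc : 0 ≤ c) (hcd : c ≤ d) (hd1 : d ≤ 1)
    (hE : ∀ a, |Q a - q a| ≤ E) {θ' : A → ℝ}
    (hθ' : ∀ a, θ' a = d * f a * (Q a - ∑ b, Q b * f b)) :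
    c / 2 * ∑ a, (f a * (q a - ∑ b, f b * q b)) ^ 2 - 2 * E ^ 2
      ≤ ∑ a, f a * (θ' a - ∑ b, f b * θ' b) * q a := by
  set v := ∑ b, f b * q b with hv
  have hfle : ∀ a, f a ≤ 1 := fun a => by
    rw [← hf1]; exact Finset.single_le_sum (fun b _ => hf0 b) (Finset.mem_univ a)
  have h1 : ∑ a, f a * (θ' a - ∑ b, f b * θ' b) * q a = ∑ a, f a * θ' a * (q a - v) := by
    have h2 : ∀ a, f a * (θ' a - ∑ b, f b * θ' b) * q a
        = f a * θ' a * q a - (∑ b, f b * θ' b) * (f a * q a) := fun a => by ring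
    rw [Finset.sum_congr rfl fun a _ => h2 a]
    simp only [mul_sub, Finset.sum_sub_distrib, ← Finset.mul_sum, ← Finset.sum_mul, ← hv]
  have hE2 : ∀ a, |(Q a - q a) - (∑ b, Q b * f b - v)| ≤ 2 * E := by
    intro a
    have h2 : ∑ b, Q b * f b - v = ∑ b, f b * (Q b - q b) := by
      rw [hv, ← Finset.sum_sub_distrib]
      exact Finset.sum_congr rfl fun b _ => by ring
    have h3 := abs_sum_mul_le hf0 hf1 hE
    rw [h2]
    have := abs_sub (Q a - q a) (∑ b, f b * (Q b - q b))
    linarith [hE a]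
  have hterm : ∀ a, d * (1 / 2 * (f a * (q a - v)) ^ 2 - 2 * E ^ 2 * f a)
      ≤ f a * θ' a * (q a - v) := by
    intro a
    set ε := (Q a - q a) - (∑ b, Q b * f b - v) with hε
    have hεE : ε ^ 2 ≤ 4 * E ^ 2 := by
      have := sq_le_sq' (by linarith [(abs_le.1 (hE2 a)).1]) (abs_le.1 (hE2 a)).2
      linarith
    have h2 : f a * θ' a * (q a - v) = d * (f a ^ 2 * ((q a - v) * ((q a - v) + ε))) := by
      rw [hθ' a, hε]; ring
    rw [h2]
    refine mul_le_mul_of_nonneg_left ?_ (hc.trans hcd)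
    have h3 : (q a - v) ^ 2 / 2 - ε ^ 2 / 2 ≤ (q a - v) * ((q a - v) + ε) := by
      nlinarith [sq_nonneg (q a - v + ε)]
    have h4 := mul_le_mul_of_nonneg_left h3 (sq_nonneg (f a))
    have h5 : f a ^ 2 * ε ^ 2 ≤ f a * (4 * E ^ 2) :=
      mul_le_mul (by nlinarith [hf0 a, hfle a]) hεE (sq_nonneg _) (hf0 a)
    nlinarith
  rw [h1]
  refine le_trans ?_ (Finset.sum_le_sum fun a _ => hterm a)
  rw [← Finset.mul_sum, Finset.sum_sub_distrib, ← Finset.mul_sum, ← Finset.mul_sum, hf1]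
  have hG : 0 ≤ ∑ a, (f a * (q a - v)) ^ 2 := Finset.sum_nonneg fun a _ => sq_nonneg _
  nlinarith [mul_le_mul_of_nonneg_right hcd hG, mul_le_mul_of_nonneg_right hd1 (sq_nonneg E)]

theorem exists_tendsto_of_hasDerivAt_nonneg {u u' : ℝ → ℝ} {T b : ℝ}
    (hu : ∀ s, T ≤ s → HasDerivAt u (u' s) s) (h : ∀ s, T ≤ s → 0 ≤ u' s)
    (hb : ∀ s, T ≤ s → u s ≤ b) : ∃ l, Tendsto u atTop (𝓝 l) := by
  have hmono : Monotone fun s => u (max s T) := fun s t hst =>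
    le_of_hasDerivAt_nonneg hu h (le_max_right _ _) (max_le_max_right T hst)
  have hbdd : BddAbove (range fun s => u (max s T)) :=
    ⟨b, by rintro _ ⟨s, rfl⟩; exact hb _ (le_max_right _ _)⟩
  refine ⟨_, (tendsto_atTop_ciSup hmono hbdd).congr' ?_⟩
  filter_upwards [eventually_ge_atTop T] with s hs
  simp [max_eq_left hs]

/-- If the optimal actions carry at least half of the mass of a policy, then its suboptimality is
controlled by its policy gradient. -/
theorem sq_suboptimality_le (hp0 : ∀ x a x', 0 ≤ p x a x')
    (hp1 : ∀ x a, ∑ x', p x a x' = 1) (hγ0 : 0 ≤ γ) (hγ1 : γ < 1) {f q : X → A → ℝ}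
    (hf : IsPolicy f) (hq : IsActionValue p r γ f q) {V : X → ℝ} {S : X → Finset A}
    (hV : ∀ x, ∑ a, f x a * q x a ≤ V x)
    (hS : ∀ x, ∀ a ∈ S x, r x a + γ * ∑ x', p x a x' * V x' = V x)
    (hS2 : ∀ x, 1 / 2 ≤ ∑ a ∈ S x, f x a) (x : X) :
    ((1 - γ) * (V x - ∑ a, f x a * q x a)) ^ 2
      ≤ 4 * Fintype.card A * ∑ x, ∑ a, (f x a * (q x a - ∑ b, f x b * q x b)) ^ 2 := by
  set v : X → ℝ := fun x => ∑ a, f x a * q x a with hv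
  have : Nonempty X := ⟨x⟩
  obtain ⟨y, hy⟩ := Finite.exists_max fun x => V x - v x
  have hγ' : 0 < 1 - γ := sub_pos.2 hγ1
  set m := V y - v y with hm
  have hm0 : 0 ≤ m := sub_nonneg.2 (hV y)
  have hact : ∀ a ∈ S y, f y a * m ≤ f y a * (q y a - v y) + f y a * (γ * m) := by
    intro a ha
    have h1 : ∑ x', p y a x' * (V x' - v x') ≤ m := by
      calc _ ≤ ∑ x', p y a x' * m :=
            Finset.sum_le_sum fun x' _ => mul_le_mul_of_nonneg_left (hy x') (hp0 _ _ _)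
        _ = m := by rw [← Finset.sum_mul, hp1, one_mul]
    have h2 : m = q y a - v y + γ * ∑ x', p y a x' * (V x' - v x') := by
      simp only [mul_sub, Finset.sum_sub_distrib]
      rw [hm, ← hS y a ha, hq y a]
      ring
    rw [← mul_add]
    refine mul_le_mul_of_nonneg_left ?_ (hf.1 y a)
    have := mul_le_mul_of_nonneg_left h1 hγ0
    linarith
  have hsum := Finset.sum_le_sum hact
  rw [Finset.sum_add_distrib, ← Finset.sum_mul, ← Finset.sum_mul] at hsum
  set g := ∑ a ∈ S y, f y a * (q y a - v y) with hg
  have hmg : (1 - γ) * m ≤ 2 * g := by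
    nlinarith [mul_le_mul_of_nonneg_right (hS2 y) (mul_nonneg hγ'.le hm0)]
  have hg2 : g ^ 2 ≤ Fintype.card A * ∑ x, ∑ a, (f x a * (q x a - v x)) ^ 2 := by
    calc g ^ 2 ≤ (S y).card * ∑ a ∈ S y, (f y a * (q y a - v y)) ^ 2 := sq_sum_le_card_mul_sum_sq
      _ ≤ Fintype.card A * ∑ a, (f y a * (q y a - v y)) ^ 2 := by
          gcongr
          · exact Finset.card_le_univ _
          · exact Finset.subset_univ _
      _ ≤ _ := by
          gcongr
          exact Finset.single_le_sum (f := fun x => ∑ a, (f x a * (q x a - v x)) ^ 2)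
            (fun x _ => Finset.sum_nonneg fun a _ => sq_nonneg _) (Finset.mem_univ y)
  have hxm : (1 - γ) * (V x - v x) ≤ 2 * g :=
    (mul_le_mul_of_nonneg_left (hy x) hγ'.le).trans hmg
  have := pow_le_pow_left₀ (mul_nonneg hγ'.le (sub_nonneg.2 (hV x))) hxm 2
  change ((1 - γ) * (V x - v x)) ^ 2 ≤ _
  linarith

/-- Derivative of the discounted return in terms of the discounted visitation distribution. -/
theorem sum_initial_mul_deriv {μ D d h : X → ℝ} {f : X → A → ℝ}
    (hd : ∀ x', d x' = γ * ∑ x, d x * policyKer p f x x' + (1 - γ) * μ x')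
    (hD : ∀ x, D x = h x + γ * ∑ x', policyKer p f x x' * D x') :
    (1 - γ) * ∑ x, μ x * D x = ∑ x, d x * h x := by
  have h1 : ∑ x, d x * D x = ∑ x, d x * h x + γ * ∑ x, d x * ∑ x', policyKer p f x x' * D x' := by
    rw [Finset.mul_sum, ← Finset.sum_add_distrib]
    refine Finset.sum_congr rfl fun x _ => ?_
    rw [hD x]; ring
  have h2 : ∑ x, d x * D x
      = γ * ∑ x, d x * ∑ x', policyKer p f x x' * D x' + (1 - γ) * ∑ x, μ x * D x := by
    have h3 : ∑ x, d x * ∑ x', policyKer p f x x' * D x'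
        = ∑ x', (∑ x, d x * policyKer p f x x') * D x' := by
      simp only [Finset.mul_sum, Finset.sum_mul]
      rw [Finset.sum_comm]
      simp only [mul_assoc]
    rw [h3, Finset.mul_sum, Finset.mul_sum, ← Finset.sum_add_distrib]
    refine Finset.sum_congr rfl fun x _ => ?_
    conv_lhs => rw [hd x]
    ring
  linarith

/-- In logarithmic time, softmax policy gradient with a square integrable critic error is optimal up
to `O(1 / s)`. -/
theorem exists_suboptimality_le [Nonempty A] (hp0 : ∀ x a x', 0 ≤ p x a x')
    (hp1 : ∀ x a, ∑ x', p x a x' = 1) (hr : ∀ x a, 0 ≤ r x a ∧ r x a ≤ 1) (hγ0 : 0 ≤ γ)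
    (hγ1 : γ < 1) {μ : X → ℝ} (hμ0 : ∀ x, 0 ≤ μ x) (hμ1 : ∑ x, μ x = 1)
    {θ q Q : ℝ → X → A → ℝ} {d : ℝ → X → ℝ} {c K T : ℝ} (hc : 0 < c) (hT : 1 ≤ T)
    (hq : ∀ s, IsActionValue p r γ (softmaxPol (θ s)) (q s))
    (hdc : ∀ s x, c ≤ d s x) (hd1 : ∀ s, ∑ x, d s x = 1)
    (hd : ∀ s x', d s x' = γ * ∑ x, d s x * policyKer p (softmaxPol (θ s)) x x' + (1 - γ) * μ x')
    (hE : ∀ s, T ≤ s → ∀ x a, |Q s x a - q s x a| ≤ K * (1 + s ^ 2)⁻¹)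
    (hθ : ∀ s, T ≤ s → ∀ x a, HasDerivAt (fun s => θ s x a)
      (d s x * softmaxPol (θ s) x a * (Q s x a - ∑ a', Q s x a' * softmaxPol (θ s) x a')) s) :
    ∃ C T' : ℝ, 0 < C ∧ 0 < T' ∧ ∀ s, T' ≤ s → ∀ f qf, IsPolicy f → IsActionValue p r γ f qf →
      ∑ x, μ x * ∑ a, f x a * qf x a - ∑ x, μ x * ∑ a, softmaxPol (θ s) x a * q s x a ≤ C / s := by
  have hγ' : 0 < 1 - γ := sub_pos.2 hγ1
  have hpol := fun s => isPolicy_softmaxPol (θ s)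
  have hdle : ∀ s x, d s x ≤ 1 := fun s x => by
    rw [← hd1 s]
    exact Finset.single_le_sum (fun y _ => hc.le.trans (hdc s y)) (Finset.mem_univ x)
  set V : ℝ → X → ℝ := fun s x => ∑ a, softmaxPol (θ s) x a * q s x a with hV
  set G : ℝ → ℝ := fun s => ∑ x, ∑ a, (softmaxPol (θ s) x a * (q s x a - V s x)) ^ 2 with hG
  -- derivatives of the state values
  have hder : ∀ s, ∃ D : X → ℝ, T ≤ s → (∀ x, HasDerivAt (fun s => V s x) (D x) s) ∧
      (∀ x, -(2 * K ^ 2 / (1 - γ) / s ^ 2) ≤ D x) ∧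
      c ^ 2 / 2 * G s - 2 * K ^ 2 / s ^ 2 ≤ (1 - γ) * ∑ x, μ x * D x := by
    intro s
    by_cases hs : T ≤ s
    · obtain ⟨D, hD1, -, hD3⟩ := exists_hasDerivAt_value hp0 hp1 hγ0 hγ1 hpol hq
        (fun x a => hasDerivAt_softmaxPol (hθ s hs x) a)
      have hEs : (K * (1 + s ^ 2)⁻¹) ^ 2 ≤ K ^ 2 / s ^ 2 := by
        have hs0 : 0 < s := by linarith
        rw [mul_pow, inv_pow, ← div_eq_mul_inv]
        gcongr
        nlinarith
      have himp := fun x => local_improvement_ge (hpol s |>.1 x) (hpol s |>.2 x) hc.le (hdc s x)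
        (hdle s x) (hE s hs x) fun a => rfl
      refine ⟨D, fun _ => ⟨hD1, fun x => ?_, ?_⟩⟩
      · have := le_div_of_le_add_discounted (u := fun x => -D x) (h := 2 * K ^ 2 / s ^ 2) hγ0 hγ1
          (policyKer_nonneg hp0 (hpol s)) (policyKer_sum hp1 (hpol s)) (fun x => by
            simp only [mul_neg, Finset.sum_neg_distrib]
            rw [hD3 x]
            have h1 : 0 ≤ c / 2 * ∑ a, (softmaxPol (θ s) x a * (q s x a - V s x)) ^ 2 :=
              mul_nonneg (by linarith) (Finset.sum_nonneg fun a _ => sq_nonneg _)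
            have h2 := himp x
            have h3 : 2 * K ^ 2 / s ^ 2 = 2 * (K ^ 2 / s ^ 2) := by ring
            rw [h3]
            linarith) x
        rw [div_right_comm]
        linarith
      · rw [sum_initial_mul_deriv (hd s) hD3]
        calc _ ≤ ∑ x, d s x * (c / 2 * ∑ a, (softmaxPol (θ s) x a * (q s x a - V s x)) ^ 2
              - 2 * (K ^ 2 / s ^ 2)) := by
              simp only [mul_sub, Finset.sum_sub_distrib, ← Finset.sum_mul, hd1]
              have h1 : c ^ 2 / 2 * G s ≤ ∑ x, d s x *
                  (c / 2 * ∑ a, (softmaxPol (θ s) x a * (q s x a - V s x)) ^ 2) := by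
                rw [hG, Finset.mul_sum]
                refine Finset.sum_le_sum fun x _ => ?_
                have h2 : 0 ≤ c / 2 * ∑ a, (softmaxPol (θ s) x a * (q s x a - V s x)) ^ 2 :=
                  mul_nonneg (by linarith) (Finset.sum_nonneg fun a _ => sq_nonneg _)
                linarith [mul_le_mul_of_nonneg_right (hdc s x) h2]
              simp only [mul_sub] at h1
              have h3 : 2 * K ^ 2 / s ^ 2 = 2 * (K ^ 2 / s ^ 2) := by ring
              linarith
          _ ≤ _ := by
              refine Finset.sum_le_sum fun x _ =>
                mul_le_mul_of_nonneg_left ?_ (hc.le.trans (hdc s x))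
              linarith [himp x]
    · exact ⟨0, fun h => absurd h hs⟩
  choose D hD using hder
  -- convergence of the state values
  have hsub : ∀ k s : ℝ, T ≤ s → HasDerivAt (fun s => k / s) (-(k / s ^ 2)) s := by
    intro k s hs
    have hs0 : s ≠ 0 := by linarith
    refine ((hasDerivAt_inv hs0).const_mul k).congr_deriv ?_
    ring
  have hconv : ∀ x, ∃ l, Tendsto (fun s => V s x) atTop (𝓝 l) := by
    intro x
    set k := 2 * K ^ 2 / (1 - γ) with hk
    have hk0 : 0 ≤ k := by positivity
    obtain ⟨l, hl⟩ := exists_tendsto_of_hasDerivAt_nonneg (T := T) (b := 1 / (1 - γ))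
      (u := fun s => V s x - k / s)
      (fun s hs => ((hD s hs).1 x).fun_sub (hsub k s hs))
      (fun s hs => by linarith [(hD s hs).2.1 x])
      (fun s hs => by
        have h1 := (abs_le.1 ((hq s).abs_state_le hp0 hp1 hr hγ0 hγ1 (hpol s) x)).2
        have h2 : 0 ≤ k / s := div_nonneg hk0 (by linarith)
        linarith)
    refine ⟨l + 0, ?_⟩
    have h2 : Tendsto (fun s : ℝ => k / s) atTop (𝓝 0) := tendsto_const_nhds.div_atTop tendsto_id
    exact (hl.add h2).congr fun s => by ring
  choose Vi hVi using hconv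
  set qi : X → A → ℝ := fun x a => r x a + γ * ∑ x', p x a x' * Vi x' with hqi
  have hqlim : ∀ x a, Tendsto (fun s => q s x a) atTop (𝓝 (qi x a)) := by
    intro x a
    have : (fun s => q s x a) = fun s => r x a + γ * ∑ x', p x a x' * V s x' := by
      ext s; exact hq s x a
    rw [this]
    exact ((tendsto_finsetSum _ fun x' _ => (hVi x').const_mul (p x a x')).const_mul γ).const_add _
  have hηlim : Tendsto (fun s : ℝ => K * (1 + s ^ 2)⁻¹) atTop (𝓝 0) := by
    have h1 : Tendsto (fun s : ℝ => 1 + s ^ 2) atTop atTop :=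
      tendsto_atTop_add_const_left _ _ (tendsto_pow_atTop two_ne_zero)
    simpa using h1.inv_tendsto_atTop.const_mul K
  have hQlim : ∀ x a, Tendsto (fun s => Q s x a) atTop (𝓝 (qi x a)) := by
    intro x a
    have h1 : Tendsto (fun s => Q s x a - q s x a) atTop (𝓝 0) := by
      refine squeeze_zero_norm' ?_ hηlim
      filter_upwards [eventually_ge_atTop T] with s hs
      exact hE s hs x a
    have h2 := h1.add (hqlim x a)
    simpa using h2
  have hpertlim : ∀ (u : ℝ → X → A → ℝ) x, (∀ a, Tendsto (fun s => u s x a) atTop (𝓝 0)) →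
      Tendsto (fun s => ∑ a, softmaxPol (θ s) x a * u s x a) atTop (𝓝 0) := by
    intro u x hu
    have h1 : Tendsto (fun s => ∑ a, |u s x a|) atTop (𝓝 0) := by
      simpa using tendsto_finsetSum Finset.univ fun a _ => (hu a).abs
    refine squeeze_zero_norm (fun s => ?_) h1
    refine (Finset.abs_sum_le_sum_abs _ _).trans (Finset.sum_le_sum fun a _ => ?_)
    rw [abs_mul, abs_of_pos (softmaxPol_pos _ _ _)]
    exact mul_le_of_le_one_left (abs_nonneg _) ((hpol s).le_one x a)
  have hVhat : ∀ x, Tendsto (fun s => ∑ a, Q s x a * softmaxPol (θ s) x a) atTop (𝓝 (Vi x)) := by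
    intro x
    have h1 := (hVi x).add (hpertlim (fun s x a => Q s x a - q s x a) x fun a => by
      simpa using (hQlim x a).sub (hqlim x a))
    rw [add_zero] at h1
    refine h1.congr fun s => ?_
    rw [hV, ← Finset.sum_add_distrib]
    exact Finset.sum_congr rfl fun a _ => by ring
  have hopt : ∀ x a, qi x a ≤ Vi x := fun x a =>
    limit_action_value_le hc (fun s _ => ⟨hdc s x, hdle s x⟩) (fun s hs => hθ s hs x) (hQlim x)
      (hVhat x) a
  -- the limit values dominate the values of every policy
  have hdom : ∀ f qf, IsPolicy f → IsActionValue p r γ f qf → ∀ x, ∑ a, f x a * qf x a ≤ Vi x := by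
    intro f qf hf hqf x
    have := le_div_of_le_add_discounted (u := fun x => ∑ a, f x a * qf x a - Vi x) (h := 0) hγ0 hγ1
      (policyKer_nonneg hp0 hf) (policyKer_sum hp1 hf) (fun x => by
        simp only [mul_sub, Finset.sum_sub_distrib]
        rw [hqf.state_eq x]
        have h1 : ∑ a, f x a * qi x a ≤ Vi x := by
          calc _ ≤ ∑ a, f x a * Vi x :=
                Finset.sum_le_sum fun a _ => mul_le_mul_of_nonneg_left (hopt x a) (hf.1 x a)
            _ = Vi x := by rw [← Finset.sum_mul, hf.2, one_mul]
        have h2 : ∑ a, f x a * qi x a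
            = ∑ a, f x a * r x a + γ * ∑ x', policyKer p f x x' * Vi x' := by
          rw [sum_policyKer_mul, Finset.mul_sum, ← Finset.sum_add_distrib]
          exact Finset.sum_congr rfl fun a _ => by rw [hqi]; ring
        linarith) x
    rw [zero_div] at this
    linarith
  -- optimal actions eventually carry at least half of the mass
  set S : X → Finset A := fun x => Finset.univ.filter fun a => qi x a = Vi x with hS
  have hmass : ∀ᶠ s in atTop, ∀ x, 1 / 2 ≤ ∑ a ∈ S x, softmaxPol (θ s) x a := by
    rw [eventually_all]
    intro x
    have hgap : Tendsto (fun s => ∑ a, softmaxPol (θ s) x a * (Vi x - qi x a)) atTop (𝓝 0) := by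
      have h1 := ((hVi x).const_sub (Vi x)).add (hpertlim (fun s x a => q s x a - qi x a) x
        fun a => by simpa using (hqlim x a).sub_const (qi x a))
      rw [sub_self, add_zero] at h1
      refine h1.congr fun s => ?_
      simp only [hV, mul_sub, Finset.sum_sub_distrib, ← Finset.sum_mul, (hpol s).2 x]
      ring
    have hsmall : ∀ a ∈ (S x)ᶜ, Tendsto (fun s => softmaxPol (θ s) x a) atTop (𝓝 0) := by
      intro a ha
      have hlt : 0 < Vi x - qi x a := by
        have hne : qi x a ≠ Vi x := by simpa [hS] using ha
        exact sub_pos.2 (lt_of_le_of_ne (hopt x a) hne)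
      have h1 := hgap.div_const (Vi x - qi x a)
      rw [zero_div] at h1
      refine squeeze_zero (fun s => (softmaxPol_pos _ _ _).le) (fun s => ?_) h1
      rw [le_div_iff₀ hlt]
      exact Finset.single_le_sum (f := fun a => softmaxPol (θ s) x a * (Vi x - qi x a))
        (fun b _ => mul_nonneg (softmaxPol_pos _ _ _).le (sub_nonneg.2 (hopt x b)))
        (Finset.mem_univ a)
    have h2 := tendsto_finsetSum (S x)ᶜ hsmall
    rw [Finset.sum_const_zero] at h2
    filter_upwards [h2.eventually (ge_mem_nhds (show (0 : ℝ) < 1 / 2 by norm_num))] with s hs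
    have := Finset.sum_add_sum_compl (S x) fun a => softmaxPol (θ s) x a
    rw [softmaxPol_sum] at this
    linarith
  obtain ⟨T', hT'⟩ := eventually_atTop.1 (hmass.and (eventually_ge_atTop T))
  -- the differential inequality for the suboptimality
  set δ : ℝ → ℝ := fun s => ∑ x, μ x * Vi x - ∑ x, μ x * V s x with hδ
  set N : ℝ := (Fintype.card A : ℝ) with hN
  have hN0 : 0 < N := by
    rw [hN]; exact_mod_cast Fintype.card_pos
  have hX : Nonempty X := by
    by_contra h
    rw [not_nonempty_iff] at h
    simp at hμ1
  have hGδ : ∀ s, T' ≤ s → (1 - γ) ^ 2 * δ s ^ 2 ≤ 4 * N * G s := by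
    intro s hs
    obtain ⟨y, hy⟩ := Finite.exists_max fun x => Vi x - V s x
    have h1 := sq_suboptimality_le hp0 hp1 hγ0 hγ1 (hpol s) (hq s)
      (hdom _ _ (hpol s) (hq s)) (S := S) (fun x a ha => (Finset.mem_filter.1 ha).2)
      (hT' s hs).1 y
    have hδ' : δ s = ∑ x, μ x * (Vi x - V s x) := by
      simp only [hδ, mul_sub, Finset.sum_sub_distrib]
    have h2 : 0 ≤ δ s := by
      rw [hδ']
      exact Finset.sum_nonneg fun x _ => mul_nonneg (hμ0 x)
        (sub_nonneg.2 (hdom _ _ (hpol s) (hq s) x))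
    have h3 : δ s ≤ Vi y - V s y := by
      calc δ s ≤ ∑ x, μ x * (Vi y - V s y) := by
            rw [hδ']
            exact Finset.sum_le_sum fun x _ => mul_le_mul_of_nonneg_left (hy x) (hμ0 x)
        _ = _ := by rw [← Finset.sum_mul, hμ1, one_mul]
    have h4 := pow_le_pow_left₀ h2 h3 2
    calc _ ≤ (1 - γ) ^ 2 * (Vi y - V s y) ^ 2 := mul_le_mul_of_nonneg_left h4 (sq_nonneg _)
      _ = ((1 - γ) * (Vi y - V s y)) ^ 2 := by ring
      _ ≤ _ := h1
  have hδd : ∀ s, T' ≤ s → HasDerivAt δ (-∑ x, μ x * D s x) s := fun s hs =>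
    (HasDerivAt.fun_sum fun x _ => ((hD s (hT' s hs).2).1 x).const_mul (μ x)).const_sub _
  set k₁ := c ^ 2 * (1 - γ) / (8 * N) with hk₁
  set k₂ := 2 * K ^ 2 / (1 - γ) with hk₂
  have hk₁0 : 0 < k₁ := by positivity
  have hk₂0 : 0 ≤ k₂ := by positivity
  have hode : ∀ s, T' ≤ s → -∑ x, μ x * D s x ≤ -(k₁ * δ s ^ 2) + k₂ / s ^ 2 := by
    intro s hs
    have h1 := (hD s (hT' s hs).2).2.2
    have h2 := hGδ s hs
    have h3 : (1 - γ) * (k₁ * δ s ^ 2) ≤ c ^ 2 / 2 * G s := by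
      have : (1 - γ) * (k₁ * δ s ^ 2) = c ^ 2 / (8 * N) * ((1 - γ) ^ 2 * δ s ^ 2) := by
        rw [hk₁]; ring
      rw [this]
      refine (mul_le_mul_of_nonneg_left h2 (by positivity)).trans (le_of_eq ?_)
      field_simp
      ring
    have h4 : (1 - γ) * (k₂ / s ^ 2) = 2 * K ^ 2 / s ^ 2 := by
      rw [hk₂]; field_simp
    have h5 : 0 ≤ (1 - γ) * (∑ x, μ x * D s x - k₁ * δ s ^ 2 + k₂ / s ^ 2) := by
      rw [mul_add, mul_sub, h4]
      linarith
    linarith [nonneg_of_mul_nonneg_right h5 hγ']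
  have hT'1 : 1 ≤ T' := hT.trans (hT' T' le_rfl).2
  set C := 1 + (2 + k₂) / k₁ + |δ T'| * T' with hC
  have hCk : 1 + k₂ < k₁ * C := by
    have h1 : k₁ * ((2 + k₂) / k₁) = 2 + k₂ := by field_simp
    have h2 : 0 ≤ k₁ * (|δ T'| * T') := by positivity
    rw [hC, mul_add, mul_add, h1]
    linarith
  have hC1 : 1 ≤ C := by
    have h1 : 0 ≤ (2 + k₂) / k₁ := by positivity
    have h2 : 0 ≤ |δ T'| * T' := by positivity
    linarith
  have hδC := le_barrier hδd (fun s hs => hsub C s (hT' s hs).2)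
    (by
      rw [le_div_iff₀ (by linarith)]
      have h1 : 0 ≤ (2 + k₂) / k₁ := by positivity
      nlinarith [le_abs_self (δ T')])
    (fun s hs heq => by
      refine (hode s hs).trans_lt ?_
      have hs0 : 0 < s := by linarith
      have h1 : -(k₁ * δ s ^ 2) + k₂ / s ^ 2 - -(C / s ^ 2) = (C + k₂ - C * (k₁ * C)) / s ^ 2 := by
        rw [heq]; ring
      have h2 : (C + k₂ - C * (k₁ * C)) / s ^ 2 < 0 :=
        div_neg_of_neg_of_pos (by nlinarith) (by positivity)
      linarith)
  refine ⟨C, T', by linarith, by linarith, fun s hs f qf hf hqf => le_trans ?_ (hδC s hs)⟩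
  simp only [hδ]
  have := Finset.sum_le_sum fun x (_ : x ∈ Finset.univ) =>
    mul_le_mul_of_nonneg_left (hdom f qf hf hqf x) (hμ0 x)
  linarith
end Bellman

/-- The state marginal of a stationary distribution of the restarted chain. -/
theorem IsStationaryDist.actorKer_marginal {X A : Type*} [Fintype X] [Fintype A] [Nonempty A]
    {p : X → A → X → ℝ} {μ : X → ℝ} {γ : ℝ} {f : X → A → ℝ} {σ : X × A → ℝ}
    (hf : IsPolicy f) (hσ : IsStationaryDist (actorKer γ p μ f) σ) :
    (∀ x a, σ (x, a) = (∑ b, σ (x, b)) * f x a) ∧ ∑ x, ∑ b, σ (x, b) = 1 ∧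
      ∀ x', ∑ b, σ (x', b)
        = γ * ∑ x, (∑ b, σ (x, b)) * policyKer p f x x' + (1 - γ) * μ x' := by
  obtain ⟨-, h1, h2⟩ := hσ
  have h3 : ∀ x a, σ (x, a) = (∑ ξ : X × A, σ ξ * ptilde γ p μ ξ.1 ξ.2 x) * f x a := by
    intro x a
    rw [h2 (x, a), Finset.sum_mul]
    exact Finset.sum_congr rfl fun ξ _ => by simp only [actorKer]; ring
  have h4 : ∀ x, ∑ b, σ (x, b) = ∑ ξ : X × A, σ ξ * ptilde γ p μ ξ.1 ξ.2 x := by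
    intro x
    rw [Finset.sum_congr rfl fun b _ => h3 x b, ← Finset.mul_sum, hf.2 x, mul_one]
  have h5 : ∀ x a, σ (x, a) = (∑ b, σ (x, b)) * f x a := fun x a => by rw [h4 x]; exact h3 x a
  refine ⟨h5, by rw [← h1, Fintype.sum_prod_type], fun x' => ?_⟩
  have h6 : ∀ ξ : X × A, σ ξ * ptilde γ p μ ξ.1 ξ.2 x'
      = γ * (σ ξ * p ξ.1 ξ.2 x') + (1 - γ) * μ x' * σ ξ := fun ξ => by
    simp only [ptilde]; ring
  rw [h4 x', Finset.sum_congr rfl fun ξ _ => h6 ξ, Finset.sum_add_distrib, ← Finset.mul_sum,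
    ← Finset.mul_sum, h1, mul_one, Fintype.sum_prod_type]
  congr 2
  refine Finset.sum_congr rfl fun x _ => ?_
  rw [policyKer, Finset.mul_sum]
  exact Finset.sum_congr rfl fun a _ => by rw [h5 x a]; ring

theorem actor_convergence_rate
    {X A : Type*} [Fintype X] [Fintype A] [Nonempty X] [Nonempty A]
    [DecidableEq X] [DecidableEq A]
    (p : X → A → X → ℝ) (μ : X → ℝ) (r : X → A → ℝ) (γ α : ℝ)
    (hp0 : ∀ x a x', 0 ≤ p x a x') (hp1 : ∀ x a, ∑ x', p x a x' = 1)
    (hμ0 : ∀ x, 0 ≤ μ x) (hμ1 : ∑ x, μ x = 1)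
    (hr : ∀ x a, 0 ≤ r x a ∧ r x a ≤ 1) (hγ : 0 < γ ∧ γ < 1) (hα : 0 < α)
    (hμpos : ∀ x, 0 < μ x)
    (sigsta : (X → A → ℝ) → X × A → ℝ)
    (hsig : ∀ θ : X → A → ℝ,
      IsStationaryDist (actorKer γ p μ (softmaxPol θ)) (sigsta (softmaxPol θ)))
    (hsigLip : ∃ L : ℝ, ∀ f f' : X → A → ℝ,
      ∑ ξ : X × A, |sigsta f ξ - sigsta f' ξ| ≤ L * ∑ x, ∑ a, |f x a - f' x a|)
    (hergA : ∀ θ : X → A → ℝ, ∃ n, 0 < n ∧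
      ∀ ξ ξ' : X × A, 0 < kpow (actorKer γ p μ (softmaxPol θ)) n ξ ξ')
    (pista : (X → A → ℝ) → X × A → ℝ)
    (hpi : ∀ (η : ℝ) (θ : X → A → ℝ), 0 ≤ η → η < 1 →
      IsStationaryDist (criticKer p (explorePol η θ)) (pista (explorePol η θ)))
    (hpiLip : ∃ L : ℝ, ∀ f f' : X → A → ℝ,
      ∑ ξ : X × A, |pista f ξ - pista f' ξ| ≤ L * ∑ x, ∑ a, |f x a - f' x a|)
    (hergC : ∀ (η : ℝ) (θ : X → A → ℝ), 0 ≤ η → η < 1 → ∃ n, 0 < n ∧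
      ∀ ξ ξ' : X × A, 0 < kpow (criticKer p (explorePol η θ)) n ξ ξ')
    (Qb θb : ℝ → X → A → ℝ)
    (hQode : ∀ t, 0 ≤ t → ∀ x a, HasDerivAt (fun s => Qb s x a)
      (α * pista (explorePol (etaT t) (θb t)) (x, a) *
        (r x a + γ * (∑ z, ∑ a'', Qb t z a'' * explorePol (etaT t) (θb t) z a'' * p x a z)
          - Qb t x a)) t)
    (hθode : ∀ t, 0 ≤ t → ∀ x a, HasDerivAt (fun s => θb s x a)
      (zetaT t * sigsta (softmaxPol (θb t)) (x, a) *
        (Qb t x a - ∑ a', Qb t x a' * softmaxPol (θb t) x a')) t)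
    (Vq : (X → A → ℝ) → X → A → ℝ)
    (hVq : ∀ f : X → A → ℝ, IsPolicy f → ∀ x a,
      Vq f x a = r x a + γ * ∑ x', p x a x' * ∑ a', f x' a' * Vq f x' a')
    (J : (X → A → ℝ) → ℝ)
    (hJ : ∀ f : X → A → ℝ, IsPolicy f → J f = ∑ x, μ x * ∑ a, f x a * Vq f x a)
    (fstar : X → A → ℝ) (hfstarPol : IsPolicy fstar)
    (hfstarOpt : ∀ f : X → A → ℝ, IsPolicy f → J f ≤ J fstar)
    :
    ∃ C : ℝ, 0 < C ∧ ∃ t₁ : ℝ, ∀ t, t₁ ≤ t →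
      |J fstar - J (softmaxPol (θb t))| ≤ C / Real.log t := by
  obtain ⟨hγ0, hγ1⟩ := hγ
  have hpol := fun s => isPolicy_softmaxPol (θb (Real.exp s - 1))
  have hstat := fun s => hsig (θb (Real.exp s - 1))
  have htime : ∀ s, HasDerivAt (fun s => Real.exp s - 1) (Real.exp s) s := fun s =>
    (Real.hasDerivAt_exp s).sub_const 1
  have htime0 : ∀ s : ℝ, 1 ≤ s → 0 ≤ Real.exp s - 1 := fun s hs => by
    linarith [Real.add_one_le_exp s]
  have heta : ∀ s, etaT (Real.exp s - 1) = (1 + s ^ 2)⁻¹ := fun s => by simp [etaT]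
  have hzeta : ∀ s, zetaT (Real.exp s - 1) * Real.exp s = 1 := fun s => by
    rw [zetaT, add_sub_cancel, inv_mul_cancel₀ (Real.exp_pos s).ne']
  obtain ⟨c, hc, n, hcn⟩ := exists_le_stationary_explorePol hp0 hpi hergC
  obtain ⟨x₀, hx₀⟩ := Finite.exists_min μ
  have hσ01 : ∀ s x a, 0 ≤ sigsta (softmaxPol (θb (Real.exp s - 1))) (x, a) ∧
      sigsta (softmaxPol (θb (Real.exp s - 1))) (x, a) ≤ 1 := fun s x a => by
    refine ⟨(hstat s).1 _, le_of_le_of_eq ?_ (hstat s).2.1⟩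
    exact Finset.single_le_sum (fun ξ _ => (hstat s).1 ξ) (Finset.mem_univ (x, a))
  have hθ : ∀ s, 1 ≤ s → ∀ x a, HasDerivAt (fun s => θb (Real.exp s - 1) x a)
      (sigsta (softmaxPol (θb (Real.exp s - 1))) (x, a) * (Qb (Real.exp s - 1) x a
        - ∑ a', Qb (Real.exp s - 1) x a' * softmaxPol (θb (Real.exp s - 1)) x a')) s := by
    intro s hs x a
    refine ((hθode _ (htime0 s hs) x a).comp s (htime s)).congr_deriv ?_
    rw [mul_assoc (zetaT _), mul_right_comm, hzeta, one_mul]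
  have hQ : ∀ s, 1 ≤ s → ∀ x a, HasDerivAt (fun s => Qb (Real.exp s - 1) x a)
      (Real.exp s * α * pista (explorePol (1 + s ^ 2)⁻¹ (θb (Real.exp s - 1))) (x, a) *
        (r x a + γ * (∑ z, ∑ a', Qb (Real.exp s - 1) z a' *
          explorePol (1 + s ^ 2)⁻¹ (θb (Real.exp s - 1)) z a' * p x a z)
          - Qb (Real.exp s - 1) x a)) s := by
    intro s hs x a
    refine ((hQode _ (htime0 s hs) x a).comp s (htime s)).congr_deriv ?_
    rw [heta]
    ring
  have hq : ∀ s, IsActionValue p r γ (softmaxPol (θb (Real.exp s - 1)))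
      (Vq (softmaxPol (θb (Real.exp s - 1)))) := fun s => hVq _ (hpol s)
  obtain ⟨K, T, -, hT, hE⟩ := exists_critic_error_le (r := r)
    (θ := fun s => θb (Real.exp s - 1)) (Q := fun s => Qb (Real.exp s - 1))
    (q := fun s => Vq (softmaxPol (θb (Real.exp s - 1))))
    (w := fun s x a => pista (explorePol (1 + s ^ 2)⁻¹ (θb (Real.exp s - 1))) (x, a))
    (σ := fun s x a => sigsta (softmaxPol (θb (Real.exp s - 1))) (x, a))
    hp0 hp1 hr hγ0.le hγ1 hα hc hq
    (fun s hs x a => hcn _ _ (by positivity) (inv_lt_one_of_one_lt₀ (by nlinarith)) (x, a))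
    hσ01 hQ hθ
  have hmarg := fun s => (hstat s).actorKer_marginal (hpol s)
  obtain ⟨C, T', hC, hT', hbound⟩ := exists_suboptimality_le (r := r) (K := K) (T := T)
    (c := (1 - γ) * μ x₀)
    (θ := fun s => θb (Real.exp s - 1)) (Q := fun s => Qb (Real.exp s - 1))
    (q := fun s => Vq (softmaxPol (θb (Real.exp s - 1))))
    (d := fun s x => ∑ b, sigsta (softmaxPol (θb (Real.exp s - 1))) (x, b))
    hp0 hp1 hr hγ0.le hγ1 hμ0 hμ1 (mul_pos (sub_pos.2 hγ1) (hμpos x₀)) hT hq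
    (fun s x => by
      rw [(hmarg s).2.2 x]
      have h1 := mul_le_mul_of_nonneg_left (hx₀ x) (sub_pos.2 hγ1).le
      have h2 : 0 ≤ ∑ y, (∑ b, sigsta (softmaxPol (θb (Real.exp s - 1))) (y, b)) *
          policyKer p (softmaxPol (θb (Real.exp s - 1))) y x :=
        Finset.sum_nonneg fun y _ => mul_nonneg (Finset.sum_nonneg fun b _ => (hσ01 s y b).1)
          (policyKer_nonneg hp0 (hpol s) y x)
      have h3 := mul_nonneg hγ0.le h2
      linarith)
    (fun s => (hmarg s).2.1) (fun s => (hmarg s).2.2) hE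
    (fun s hs x a => by
      rw [← (hmarg s).1 x a]
      exact hθ s (hT.trans hs) x a)
  refine ⟨C, hC, max 2 (Real.exp T'), fun t ht => ?_⟩
  have ht2 : 2 ≤ t := (le_max_left _ _).trans ht
  have hlogt : 0 < Real.log t := Real.log_pos (by linarith)
  have hlog : Real.log t ≤ Real.log (1 + t) := Real.log_le_log (by linarith) (by linarith)
  have hT't : T' ≤ Real.log t :=
    (Real.le_log_iff_exp_le (by linarith)).2 ((le_max_right _ _).trans ht)
  have h := hbound (Real.log (1 + t)) (hT't.trans hlog) fstar (Vq fstar) hfstarPol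
    (hVq fstar hfstarPol)
  simp only [Real.exp_log (show 0 < 1 + t by linarith), add_sub_cancel_left] at h
  have hpolt := isPolicy_softmaxPol (θb t)
  rw [← hJ fstar hfstarPol, ← hJ _ hpolt] at h
  rw [abs_of_nonneg (sub_nonneg.2 (hfstarOpt _ hpolt))]
  exact h.trans (div_le_div_of_nonneg_left hC.le hlogt hlog)
end
end

section
/- Vanishing fluctuations of the actor samples around the evolving stationary measure: for any fixed state-action pair ξ = (x,a) and any T > 0, lim_{N→∞} E | (1/N) Σ_{k=0}^{⌊NT⌋−1} ζ_k^N [ 1_{{(x̃_k,ã_k) = ξ}} − σ_μ^{f_{θ_k}}(ξ) ] | = 0. -/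
open MeasureTheory Filter Set
open scoped Classical

noncomputable section

lemma abs_sum_mul_sub_succ_le {w a : ℕ → ℝ} {B : ℝ} (hw0 : ∀ k, 0 ≤ w k) (hw : Antitone w)
    (ha : ∀ k, |a k| ≤ B) (n : ℕ) :
    |∑ k ∈ Finset.range n, w k * (a k - a (k + 1))| ≤ 2 * B * w 0 := by
  have key : ∀ n, |(∑ k ∈ Finset.range n, w k * (a k - a (k + 1))) + w n * a n|
      ≤ B * (2 * w 0 - w n) := by
    intro n
    induction n with
    | zero =>
      have := mul_le_mul_of_nonneg_left (ha 0) (hw0 0)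
      simp only [Finset.range_zero, Finset.sum_empty, zero_add, abs_mul, abs_of_nonneg (hw0 0)]
      linarith
    | succ n ih =>
      have h1 : |(w n - w (n + 1)) * a (n + 1)| ≤ (w n - w (n + 1)) * B := by
        have h2 : 0 ≤ w n - w (n + 1) := sub_nonneg.2 (hw n.le_succ)
        rw [abs_mul, abs_of_nonneg h2]
        exact mul_le_mul_of_nonneg_left (ha _) h2
      rw [Finset.sum_range_succ]
      rw [abs_le] at ih h1 ⊢
      constructor <;> linarith [ih.1, ih.2, h1.1, h1.2]
  have h1 := key n
  have h2 : |w n * a n| ≤ w n * B := by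
    rw [abs_mul, abs_of_nonneg (hw0 n)]
    exact mul_le_mul_of_nonneg_left (ha n) (hw0 n)
  rw [abs_le] at h1 h2 ⊢
  constructor <;> linarith [h1.1, h1.2, h2.1, h2.2]

def kerOp {S : Type*} [Fintype S] (K : S → S → ℝ) (f : S → ℝ) : S → ℝ :=
  fun s => ∑ s', K s s' * f s'

def IsStochastic {S : Type*} [Fintype S] (K : S → S → ℝ) : Prop :=
  (∀ s s', 0 ≤ K s s') ∧ ∀ s, ∑ s', K s s' = 1

section kernel

variable {S : Type*} [Fintype S]

lemma abs_sum_mul_le_of_nonneg {c f : S → ℝ} {B : ℝ} (hc : ∀ s, 0 ≤ c s)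
    (hf : ∀ s, |f s| ≤ B) : |∑ s, c s * f s| ≤ (∑ s, c s) * B := by
  rw [Finset.sum_mul]
  refine (Finset.abs_sum_le_sum_abs _ _).trans (Finset.sum_le_sum fun s _ => ?_)
  rw [abs_mul, abs_of_nonneg (hc s)]
  exact mul_le_mul_of_nonneg_left (hf s) (hc s)

lemma abs_apply_le_norm (f : S → ℝ) (s : S) : |f s| ≤ ‖f‖ := norm_le_pi_norm f s

lemma IsStochastic.norm_kerOp_le {K : S → S → ℝ} (hK : IsStochastic K) (f : S → ℝ) :
    ‖kerOp K f‖ ≤ ‖f‖ := by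
  refine (pi_norm_le_iff_of_nonneg (norm_nonneg f)).2 fun s => ?_
  have := abs_sum_mul_le_of_nonneg (hK.1 s) (abs_apply_le_norm f)
  rwa [hK.2 s, one_mul] at this

lemma IsStochastic.norm_iterate_kerOp_le {K : S → S → ℝ} (hK : IsStochastic K) (f : S → ℝ)
    (m : ℕ) : ‖(kerOp K)^[m] f‖ ≤ ‖f‖ := by
  induction m with
  | zero => simp
  | succ m ih => rw [Function.iterate_succ_apply']; exact (hK.norm_kerOp_le _).trans ih

lemma IsStochastic.antitone_norm_iterate_kerOp {K : S → S → ℝ} (hK : IsStochastic K)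
    (f : S → ℝ) : Antitone fun m => ‖(kerOp K)^[m] f‖ :=
  antitone_nat_of_succ_le fun m => by
    rw [Function.iterate_succ_apply']; exact hK.norm_kerOp_le _

lemma iterate_kerOp_apply [DecidableEq S] (K : S → S → ℝ) (n : ℕ) (f : S → ℝ) (s : S) :
    (kerOp K)^[n] f s = ∑ s', kpow K n s s' * f s' := by
  induction n generalizing s with
  | zero => simp [kpow]
  | succ n ih =>
    rw [Function.iterate_succ_apply', kerOp]
    simp_rw [ih, kpow, Finset.mul_sum, Finset.sum_mul]
    rw [Finset.sum_comm]
    simp_rw [mul_assoc]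

lemma IsStochastic.sum_kpow [DecidableEq S] {K : S → S → ℝ} (hK : IsStochastic K) (n : ℕ)
    (s : S) : ∑ s', kpow K n s s' = 1 := by
  induction n generalizing s with
  | zero => simp [kpow]
  | succ n ih =>
    simp_rw [kpow]
    rw [Finset.sum_comm]
    simp_rw [← Finset.mul_sum, ih, mul_one, hK.2]

lemma IsStationaryDist.sum_mul_kerOp {K : S → S → ℝ} {d : S → ℝ} (hd : IsStationaryDist K d)
    (f : S → ℝ) : ∑ s, d s * kerOp K f s = ∑ s, d s * f s := by
  simp_rw [kerOp, Finset.mul_sum]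
  rw [Finset.sum_comm]
  refine Finset.sum_congr rfl fun s _ => ?_
  rw [hd.2.2 s, Finset.sum_mul]
  simp_rw [mul_assoc]

lemma IsStationaryDist.sum_mul_iterate_kerOp {K : S → S → ℝ} {d : S → ℝ}
    (hd : IsStationaryDist K d) (f : S → ℝ) (m : ℕ) :
    ∑ s, d s * (kerOp K)^[m] f s = ∑ s, d s * f s := by
  induction m with
  | zero => simp
  | succ m ih => rw [Function.iterate_succ_apply', hd.sum_mul_kerOp, ih]

/-- A primitive stochastic kernel drives every function with stationary mean zero to `0`. -/
lemma IsStochastic.tendsto_norm_iterate_kerOp [DecidableEq S] [Nonempty S] {K : S → S → ℝ}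
    (hK : IsStochastic K) {d : S → ℝ} (hd : IsStationaryDist K d) {n : ℕ}
    (hn : ∀ s s', 0 < kpow K n s s') {f : S → ℝ} (hf : ∑ s, d s * f s = 0) :
    Tendsto (fun m => ‖(kerOp K)^[m] f‖) atTop (nhds 0) := by
  obtain ⟨q, hq⟩ := Finite.exists_min fun q : S × S => kpow K n q.1 q.2
  set δ := kpow K n q.1 q.2
  have hδ : 0 < δ := hn _ _
  have hd1 : ∀ s, d s ≤ 1 := fun s => hd.2.1 ▸
    Finset.single_le_sum (fun s _ => hd.1 s) (Finset.mem_univ s)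
  have hδ1 : δ ≤ 1 := by
    rw [← hK.sum_kpow n q.1]
    exact Finset.single_le_sum (f := fun s' => kpow K n q.1 s') (fun s _ => (hn _ _).le)
      (Finset.mem_univ q.2)
  have hcontr : ∀ g : S → ℝ, ∑ s, d s * g s = 0 → ‖(kerOp K)^[n] g‖ ≤ (1 - δ) * ‖g‖ := by
    intro g hg
    refine (pi_norm_le_iff_of_nonneg (mul_nonneg (by linarith) (norm_nonneg g))).2 fun s => ?_
    have h1 : (kerOp K)^[n] g s = ∑ s', (kpow K n s s' - δ * d s') * g s' := by
      simp_rw [sub_mul, Finset.sum_sub_distrib, mul_assoc, ← Finset.mul_sum]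
      rw [hg, iterate_kerOp_apply]; ring
    have h2 : ∑ s', (kpow K n s s' - δ * d s') = 1 - δ := by
      rw [Finset.sum_sub_distrib, ← Finset.mul_sum, hK.sum_kpow, hd.2.1, mul_one]
    rw [h1, ← h2]
    refine abs_sum_mul_le_of_nonneg (fun s' => ?_) (abs_apply_le_norm g)
    have := hq (s, s')
    have := mul_le_of_le_one_right hδ.le (hd1 s')
    simp only at *
    linarith
  have hbdd : BddBelow (Set.range fun m => ‖(kerOp K)^[m] f‖) :=
    ⟨0, by rintro _ ⟨m, rfl⟩; exact norm_nonneg _⟩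
  have hlim := tendsto_atTop_ciInf (hK.antitone_norm_iterate_kerOp f) hbdd
  set l := ⨅ m, ‖(kerOp K)^[m] f‖
  have hl0 : 0 ≤ l := ge_of_tendsto' hlim fun m => norm_nonneg _
  have hl1 : l ≤ (1 - δ) * l := by
    refine le_of_tendsto_of_tendsto' (hlim.comp (tendsto_add_atTop_nat n))
      (hlim.const_mul (1 - δ)) fun m => ?_
    simp only [Function.comp_apply]
    rw [add_comm, Function.iterate_add_apply]
    exact hcontr _ (by rw [hd.sum_mul_iterate_kerOp, hf])
  have : l = 0 := by nlinarith
  rwa [this] at hlim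

lemma continuous_iterate_kerOp {E : Type*} [TopologicalSpace E] {K : E → S → S → ℝ}
    {g : E → S → ℝ} (hK : Continuous K) (hg : Continuous g) (m : ℕ) :
    Continuous fun e => (kerOp (K e))^[m] (g e) := by
  induction m with
  | zero => simpa using hg
  | succ m ih =>
    simp_rw [Function.iterate_succ_apply']
    refine continuous_pi fun s => ?_
    simp only [kerOp]
    fun_prop

lemma sum_iterate_sub_kerOp (K : S → S → ℝ) (g : S → ℝ) (m : ℕ) (s : S) :
    (∑ j ∈ Finset.range m, (kerOp K)^[j] g) s
      - kerOp K (∑ j ∈ Finset.range m, (kerOp K)^[j] g) s = g s - (kerOp K)^[m] g s := by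
  induction m with
  | zero => simp [kerOp]
  | succ m ih =>
    have hadd : ∀ u v : S → ℝ, kerOp K (u + v) s = kerOp K u s + kerOp K v s := fun u v => by
      simp [kerOp, mul_add, Finset.sum_add_distrib]
    rw [Finset.sum_range_succ, hadd, Function.iterate_succ_apply', Pi.add_apply]
    linarith

/-- Uniform version of `IsStochastic.tendsto_norm_iterate_kerOp` over a compact parameter set. -/
lemma exists_forall_norm_iterate_kerOp_le {E : Type*} [TopologicalSpace E] {K : E → S → S → ℝ}
    {g : E → S → ℝ} (hK : Continuous K) (hg : Continuous g) (hKs : ∀ e, IsStochastic (K e))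
    (hlim : ∀ e, Tendsto (fun m => ‖(kerOp (K e))^[m] (g e)‖) atTop (nhds 0))
    {C : Set E} (hC : IsCompact C) {ε : ℝ} (hε : 0 < ε) :
    ∃ m, ∀ e ∈ C, ‖(kerOp (K e))^[m] (g e)‖ ≤ ε := by
  have h := Antitone.tendstoUniformlyOn_of_forall_tendsto hC
    (F := fun m e => ‖(kerOp (K e))^[m] (g e)‖) (f := fun _ => 0)
    (fun m => (continuous_iterate_kerOp hK hg m).norm.continuousOn)
    (fun e _ => (hKs e).antitone_norm_iterate_kerOp (g e)) continuousOn_const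
    (fun e _ => hlim e)
  rw [Metric.tendstoUniformlyOn_iff] at h
  obtain ⟨m, hm⟩ := (h ε hε).exists
  refine ⟨m, fun e he => ?_⟩
  have := hm e he
  rw [dist_comm, dist_zero_right, norm_norm] at this
  exact this.le

end kernel

section process

variable {Ω : Type*} {mΩ : MeasurableSpace Ω} {P : Measure Ω}

lemma integral_abs_le_sqrt_integral_sq [IsProbabilityMeasure P] {W : Ω → ℝ}
    (hW : MemLp W 2 P) : ∫ ω, |W ω| ∂P ≤ √(∫ ω, W ω ^ 2 ∂P) := by
  have hWi : Integrable W P := hW.integrable (by norm_num)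
  refine Real.le_sqrt_of_sq_le ?_
  set c := ∫ ω, |W ω| ∂P
  have h0 : 0 ≤ ∫ ω, (|W ω| - c) ^ 2 ∂P := integral_nonneg fun ω => sq_nonneg _
  have h1 : ∀ ω, (|W ω| - c) ^ 2 = W ω ^ 2 - (2 * c) * |W ω| + c ^ 2 := fun ω => by
    rw [sub_sq, sq_abs]; ring
  simp_rw [h1] at h0
  have h2 : Integrable (fun ω => W ω ^ 2 - (2 * c) * |W ω|) P :=
    hW.integrable_sq.sub (hWi.abs.const_mul _)
  rw [integral_add h2 (integrable_const _), integral_sub hW.integrable_sq (hWi.abs.const_mul _), integral_const_mul,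
    integral_const] at h0
  simp only [probReal_univ, smul_eq_mul, one_mul] at h0
  change 0 ≤ _ - 2 * c * c + _ at h0
  nlinarith

lemma memLp_of_abs_le [IsProbabilityMeasure P] {W : Ω → ℝ} (hW : Measurable W) {C : ℝ}
    (hC : ∀ ω, |W ω| ≤ C) : MemLp W 2 P :=
  MemLp.of_bound hW.aestronglyMeasurable C (ae_of_all _ hC)

/-- Weighted sums of bounded martingale differences are of square-root size in `L¹`. -/
lemma integral_abs_sum_martingale_difference_le [IsProbabilityMeasure P] (ℱ : Filtration ℕ mΩ)
    {D : ℕ → Ω → ℝ} {w : ℕ → ℝ} {C : ℝ} (hC : 0 ≤ C)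
    (hD : ∀ k, Measurable[ℱ (k + 1)] (D k)) (hDC : ∀ k ω, |D k ω| ≤ C)
    (hD0 : ∀ k, P[D k|ℱ k] =ᵐ[P] 0) (hw : ∀ k, |w k| ≤ 1) (n : ℕ) :
    ∫ ω, |∑ k ∈ Finset.range n, w k * D k ω| ∂P ≤ C * √n := by
  set W : ℕ → Ω → ℝ := fun n ω => ∑ k ∈ Finset.range n, w k * D k ω
  have hWm : ∀ n, Measurable[ℱ n] (W n) := fun n =>
    Finset.measurable_fun_sum _ fun k hk =>
      ((hD k).mono (ℱ.mono (Finset.mem_range.1 hk)) le_rfl).const_mul _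
  have hwD : ∀ k ω, |w k * D k ω| ≤ C := fun k ω => by
    rw [abs_mul]
    exact (mul_le_of_le_one_left (abs_nonneg _) (hw k)).trans (hDC k ω)
  have hWb : ∀ n ω, |W n ω| ≤ n * C := fun n ω => by
    refine (Finset.abs_sum_le_sum_abs _ _).trans ?_
    simpa using Finset.sum_le_sum fun k (_ : k ∈ Finset.range n) => hwD k ω
  have hDm : ∀ k, Measurable (D k) := fun k => (hD k).mono (ℱ.le _) le_rfl
  have hW2 : ∀ n, MemLp (W n) 2 P := fun n =>
    memLp_of_abs_le ((hWm n).mono (ℱ.le _) le_rfl) (hWb n)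
  have hD2 : ∀ k, MemLp (D k) 2 P := fun k => memLp_of_abs_le (hDm k) (hDC k)
  have hcross : ∀ k, ∫ ω, W k ω * D k ω ∂P = 0 := fun k => by
    have hDi : Integrable (D k) P := (hD2 k).integrable (by norm_num)
    have h1 := condExp_stronglyMeasurable_mul_of_bound (ℱ.le k) (hWm k).stronglyMeasurable hDi
      _ (ae_of_all P (hWb k))
    rw [← integral_condExp (ℱ.le k) (f := fun ω => W k ω * D k ω)]
    refine integral_eq_zero_of_ae ?_
    filter_upwards [h1, hD0 k] with ω h1 h2
    refine h1.trans ?_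
    simp [h2]
  have hsq : ∀ n : ℕ, ∫ ω, W n ω ^ 2 ∂P ≤ n * C ^ 2 := by
    intro n
    induction n with
    | zero => simp [W]
    | succ n ih =>
      have h1 : ∀ ω, W (n + 1) ω ^ 2
          = W n ω ^ 2 + 2 * w n * (W n ω * D n ω) + (w n * D n ω) ^ 2 := fun ω => by
        simp only [W, Finset.sum_range_succ]; ring
      have h2 : Integrable (fun ω => 2 * w n * (W n ω * D n ω)) P :=
        ((hW2 n).integrable_mul (hD2 n)).const_mul _
      have h3 : MemLp (fun ω => w n * D n ω) 2 P :=
        memLp_of_abs_le ((hDm n).const_mul _) (hwD n)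
      have h4 : ∫ ω, (w n * D n ω) ^ 2 ∂P ≤ C ^ 2 := by
        have := integral_mono h3.integrable_sq (integrable_const (C ^ 2))
          fun ω => sq_le_sq' (abs_le.1 (hwD n ω)).1 (abs_le.1 (hwD n ω)).2
        simpa using this
      simp_rw [h1]
      have h5 : Integrable (fun ω => W n ω ^ 2 + 2 * w n * (W n ω * D n ω)) P :=
        (hW2 n).integrable_sq.add h2
      rw [integral_add h5 h3.integrable_sq,
        integral_add (hW2 n).integrable_sq h2, integral_const_mul, hcross]
      push_cast
      linarith
  refine (integral_abs_le_sqrt_integral_sq (hW2 n)).trans ?_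
  refine (Real.sqrt_le_sqrt (hsq n)).trans ?_
  rw [mul_comm, Real.sqrt_mul (sq_nonneg C), Real.sqrt_sq hC]

lemma measurable_of_forall_apply {X A : Type*} {f : Ω → X → A → ℝ}
    (hf : ∀ x a, Measurable fun ω => f ω x a) : Measurable f :=
  measurable_pi_lambda _ fun x => measurable_pi_lambda _ (hf x)

variable {S : Type*} [Fintype S] [MeasurableSpace S] [MeasurableSingletonClass S]

lemma measurable_apply_of_forall {Z : Ω → S} (hZ : Measurable Z) {β : Type*}
    [MeasurableSpace β] {f : Ω → S → β} (hf : ∀ s, Measurable fun ω => f ω s) :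
    Measurable fun ω => f ω (Z ω) :=
  (measurable_from_prod_countable_right (f := fun q : S × Ω => f q.2 q.1) hf).comp
    (hZ.prodMk measurable_id)

/-- The increment of a predictable function along one step of a Markov transition is centred. -/
lemma condExp_apply_sub_sum_eq_zero [DecidableEq S] [IsProbabilityMeasure P]
    {m : MeasurableSpace Ω} (hm : m ≤ mΩ) {Z : Ω → S} (hZ : Measurable[mΩ] Z) {q f : Ω → S → ℝ}
    (hq : ∀ s, Measurable[m] fun ω => q ω s) (hf : ∀ s, Measurable[m] fun ω => f ω s)
    {C : ℝ} (hfC : ∀ ω s, |f ω s| ≤ C)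
    (hcond : ∀ s, P[(fun ω => if Z ω = s then (1 : ℝ) else 0)|m] =ᵐ[P] fun ω => q ω s) :
    P[(fun ω => f ω (Z ω) - ∑ s, q ω s * f ω s)|m] =ᵐ[P] 0 := by
  have hI : ∀ s, Integrable (fun ω => if Z ω = s then (1 : ℝ) else 0) P := fun s => by
    refine Integrable.of_bound (C := 1) (Measurable.aestronglyMeasurable ?_) (ae_of_all _ fun ω => ?_)
    · exact Measurable.ite (hZ (measurableSet_singleton s)) measurable_const measurable_const
    · split_ifs <;> simp
  have hqi : ∀ s, Integrable (fun ω => q ω s) P := fun s =>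
    (integrable_congr (hcond s)).1 integrable_condExp
  have hfm : ∀ s, AEStronglyMeasurable[mΩ] (fun ω => f ω s) P := fun s =>
    ((hf s).mono hm le_rfl).aestronglyMeasurable
  have hterm : ∀ s, P[(fun ω => f ω s) *
      ((fun ω => if Z ω = s then (1 : ℝ) else 0) - fun ω => q ω s)|m] =ᵐ[P] 0 := fun s => by
    have h1 := condExp_stronglyMeasurable_mul_of_bound hm (hf s).stronglyMeasurable
      ((hI s).sub (hqi s)) C (ae_of_all P fun ω => hfC ω s)
    have h2 := condExp_sub (hI s) (hqi s) m
    rw [condExp_of_stronglyMeasurable hm (hq s).stronglyMeasurable (hqi s)] at h2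
    filter_upwards [h1, h2, hcond s] with ω h1 h2 h3
    rw [h1, Pi.mul_apply, h2, Pi.sub_apply, h3]
    simp
  have hsum : (fun ω => f ω (Z ω) - ∑ s, q ω s * f ω s) = ∑ s, (fun ω => f ω s) *
      ((fun ω => if Z ω = s then (1 : ℝ) else 0) - fun ω => q ω s) := by
    ext ω
    simp [mul_sub, mul_comm]
  rw [hsum]
  refine (condExp_finsetSum (fun s _ =>
    ((hI s).sub (hqi s)).bdd_mul (hfm s) (ae_of_all P fun ω => hfC ω s)) m).trans ?_
  filter_upwards [ae_all_iff.2 hterm] with ω h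
  rw [Finset.sum_apply]
  exact Finset.sum_eq_zero fun s _ => h s

/-- Ergodic-type estimate for a chain with slowly varying predictable kernels `κ k`, whose
observables `g k` are approximately `H k - κ k H k`. -/
lemma integral_abs_weighted_sum_le [DecidableEq S] [IsProbabilityMeasure P]
    (ℱ : Filtration ℕ mΩ) {Z : ℕ → Ω → S} (hZ : ∀ k, Measurable[ℱ k] (Z k))
    {κ : ℕ → Ω → S → S → ℝ} (hκ : ∀ k ω, IsStochastic (κ k ω))
    (hκm : ∀ k s s', Measurable[ℱ k] fun ω => κ (k + 1) ω s s')
    {H g : ℕ → Ω → S → ℝ} {B : ℝ} (hHB : ∀ k ω, ‖H k ω‖ ≤ B)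
    (hHm : ∀ k s, Measurable[ℱ k] fun ω => H (k + 1) ω s)
    (hcond : ∀ k s, P[(fun ω => if Z (k + 1) ω = s then (1 : ℝ) else 0)|ℱ k]
      =ᵐ[P] fun ω => κ (k + 1) ω (Z k ω) s)
    {w : ℕ → ℝ} (hw0 : ∀ k, 0 ≤ w k) (hw1 : ∀ k, w k ≤ 1) (hw : Antitone w)
    {ε : ℝ} {n : ℕ}
    (hg : ∀ k < n, ∀ ω s, |g k ω s - (H k ω s - kerOp (κ k ω) (H k ω) s)| ≤ ε)
    (hdrift : ∀ k < n, ∀ ω s,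
      |kerOp (κ (k + 1) ω) (H (k + 1) ω) s - kerOp (κ k ω) (H k ω) s| ≤ ε) :
    ∫ ω, |∑ k ∈ Finset.range n, w k * g k ω (Z k ω)| ∂P
      ≤ 2 * B + n * (2 * ε) + 2 * B * √n := by
  have hB : 0 ≤ B := (norm_nonneg _).trans (hHB 0 (nonempty_of_isProbabilityMeasure P).some)
  set D : ℕ → Ω → ℝ := fun k ω =>
    H (k + 1) ω (Z (k + 1) ω) - kerOp (κ (k + 1) ω) (H (k + 1) ω) (Z k ω) with hDdef
  have hHs : ∀ k ω s, |H k ω s| ≤ B := fun k ω s => (abs_apply_le_norm _ s).trans (hHB k ω)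
  have hDm : ∀ k, Measurable[ℱ (k + 1)] (D k) := fun k => by
    have hle : ℱ k ≤ ℱ (k + 1) := ℱ.mono k.le_succ
    refine Measurable.sub ?_ ?_
    · exact measurable_apply_of_forall (hZ (k + 1)) fun s => (hHm k s).mono hle le_rfl
    · refine Measurable.mono ?_ hle le_rfl
      refine measurable_apply_of_forall (hZ k) fun s => ?_
      simp only [kerOp]
      exact Finset.measurable_fun_sum _ fun s' _ => (hκm k s s').mul (hHm k s')
  have hDB : ∀ k ω, |D k ω| ≤ 2 * B := fun k ω => by
    have h1 := hHs (k + 1) ω (Z (k + 1) ω)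
    have h2 := (abs_apply_le_norm _ (Z k ω)).trans
      (((hκ (k + 1) ω).norm_kerOp_le (H (k + 1) ω)).trans (hHB _ _))
    exact (abs_sub _ _).trans (by linarith)
  have hD0 : ∀ k, P[D k|ℱ k] =ᵐ[P] 0 := fun k =>
    condExp_apply_sub_sum_eq_zero (ℱ.le k) ((hZ (k + 1)).mono (ℱ.le _) le_rfl)
      (q := fun ω s => κ (k + 1) ω (Z k ω) s) (f := H (k + 1))
      (fun s => measurable_apply_of_forall (f := fun ω z => κ (k + 1) ω z s) (hZ k)
        fun z => hκm k z s) (hHm k) (hHs (k + 1)) (hcond k)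
  have hmart := integral_abs_sum_martingale_difference_le ℱ (w := w) (by linarith) hDm hDB hD0
    (fun k => abs_le.2 ⟨by linarith [hw0 k], hw1 k⟩) n
  have hDint : Integrable (fun ω => |∑ k ∈ Finset.range n, w k * D k ω|) P := by
    refine Integrable.abs (integrable_finsetSum _ fun k _ => Integrable.const_mul ?_ _)
    exact (memLp_of_abs_le ((hDm k).mono (ℱ.le _) le_rfl) (hDB k)).integrable (by norm_num)
  have hpt : ∀ ω, |∑ k ∈ Finset.range n, w k * g k ω (Z k ω)|
      ≤ (2 * B + n * (2 * ε)) + |∑ k ∈ Finset.range n, w k * D k ω| := fun ω => by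
    set e : ℕ → ℝ := fun k =>
      (g k ω (Z k ω) - (H k ω (Z k ω) - kerOp (κ k ω) (H k ω) (Z k ω))) +
        (kerOp (κ (k + 1) ω) (H (k + 1) ω) (Z k ω) - kerOp (κ k ω) (H k ω) (Z k ω))
    have hsplit : ∑ k ∈ Finset.range n, w k * g k ω (Z k ω)
        = (∑ k ∈ Finset.range n, w k * (H k ω (Z k ω) - H (k + 1) ω (Z (k + 1) ω)))
          + (∑ k ∈ Finset.range n, w k * e k) + ∑ k ∈ Finset.range n, w k * D k ω := by
      rw [← Finset.sum_add_distrib, ← Finset.sum_add_distrib]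
      refine Finset.sum_congr rfl fun k _ => ?_
      simp only [e, D]; ring
    have h1 := abs_sum_mul_sub_succ_le hw0 hw (fun k => hHs k ω (Z k ω)) n
    have h2 : |∑ k ∈ Finset.range n, w k * e k| ≤ n * (2 * ε) := by
      refine (Finset.abs_sum_le_sum_abs _ _).trans ?_
      have : ∀ k ∈ Finset.range n, |w k * e k| ≤ 2 * ε := fun k hk => by
        have hk := Finset.mem_range.1 hk
        rw [abs_mul, abs_of_nonneg (hw0 k)]
        refine (mul_le_of_le_one_left (abs_nonneg _) (hw1 k)).trans ((abs_add_le _ _).trans ?_)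
        linarith [hg k hk ω (Z k ω), hdrift k hk ω (Z k ω)]
      simpa using Finset.sum_le_sum this
    have h3 : 2 * B * w 0 ≤ 2 * B := mul_le_of_le_one_right (by linarith) (hw1 0)
    rw [hsplit]
    refine (abs_add_le _ _).trans (add_le_add_left ((abs_add_le _ _).trans ?_) _)
    linarith
  refine (integral_mono_of_nonneg (ae_of_all _ fun ω => abs_nonneg _)
    ((integrable_const _).add hDint) (ae_of_all _ hpt)).trans ?_
  rw [integral_add' (integrable_const _) hDint]
  simpa using hmart

/-- Averages of a centred observable along a chain whose primitive kernel is driven by a slowly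
varying predictable parameter vanish in `L¹`. -/
theorem tendsto_integral_abs_weighted_average [DecidableEq S] [IsProbabilityMeasure P]
    {E : Type*} [PseudoMetricSpace E] [MeasurableSpace E] [OpensMeasurableSpace E]
    {K : E → S → S → ℝ} {g : E → S → ℝ} (hK : Continuous K) (hg : Continuous g)
    (hKs : ∀ e, IsStochastic (K e)) {b : ℝ} (hgb : ∀ e, ‖g e‖ ≤ b)
    (hlim : ∀ e, Tendsto (fun m => ‖(kerOp (K e))^[m] (g e)‖) atTop (nhds 0))
    (ℱ : ℕ → Filtration ℕ mΩ) {Z : ℕ → ℕ → Ω → S} (hZ : ∀ N k, Measurable[ℱ N k] (Z N k))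
    {θ : ℕ → ℕ → Ω → E} (hθ : ∀ N k, Measurable[ℱ N k] (θ N (k + 1)))
    (hcond : ∀ N k s, P[(fun ω => if Z N (k + 1) ω = s then (1 : ℝ) else 0)|ℱ N k]
      =ᵐ[P] fun ω => K (θ N (k + 1) ω) (Z N k ω) s)
    {w : ℕ → ℕ → ℝ} (hw0 : ∀ N k, 0 ≤ w N k) (hw1 : ∀ N k, w N k ≤ 1)
    (hw : ∀ N, Antitone (w N)) {T : ℝ} (hT : 0 ≤ T) {C : Set E} (hC : IsCompact C)
    (hθC : ∀ᶠ N : ℕ in atTop, ∀ k ≤ ⌊(N : ℝ) * T⌋₊, ∀ ω, θ N k ω ∈ C) {M : ℝ}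
    (hstep : ∀ᶠ N : ℕ in atTop, ∀ k ω, dist (θ N (k + 1) ω) (θ N k ω) ≤ M / N) :
    Tendsto (fun N : ℕ => ∫ ω, |(1 / (N : ℝ)) * ∑ k ∈ Finset.range ⌊(N : ℝ) * T⌋₊,
      w N k * g (θ N k ω) (Z N k ω)| ∂P) atTop (nhds 0) := by
  refine tendsto_order.2 ⟨fun a ha => Eventually.of_forall fun N =>
    ha.trans_le (integral_nonneg fun ω => abs_nonneg _), fun ε hε => ?_⟩
  obtain ⟨ε', hε', hεT⟩ : ∃ ε' : ℝ, 0 < ε' ∧ T * (2 * ε') < ε := by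
    refine ⟨ε / (2 * (T + 1)), by positivity, ?_⟩
    rw [show T * (2 * (ε / (2 * (T + 1)))) = T * ε / (T + 1) by field_simp,
      div_lt_iff₀ (by linarith)]
    linarith
  obtain ⟨m, hm⟩ := exists_forall_norm_iterate_kerOp_le hK hg hKs hlim hC hε'
  set h : E → S → ℝ := fun e => ∑ j ∈ Finset.range m, (kerOp (K e))^[j] (g e) with hh
  have hhc : Continuous h := continuous_finsetSum _ fun j _ => continuous_iterate_kerOp hK hg j
  have hKhc : Continuous fun e => kerOp (K e) (h e) := continuous_iterate_kerOp hK hhc 1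
  have hhB : ∀ e, ‖h e‖ ≤ m * b := fun e => by
    refine (norm_sum_le _ _).trans ?_
    simpa using Finset.sum_le_sum fun j (_ : j ∈ Finset.range m) =>
      ((hKs e).norm_iterate_kerOp_le (g e) j).trans (hgb e)
  obtain ⟨δ, hδ, hδh⟩ := Metric.uniformContinuousOn_iff.1
    (hC.uniformContinuousOn_of_continuous hKhc.continuousOn) ε' hε'
  have hMN : ∀ᶠ N : ℕ in atTop, M / N < δ :=
    (tendsto_const_div_atTop_nhds_zero_nat M).eventually_lt_const hδ
  set B : ℝ := m * b
  have hbound : Tendsto (fun N : ℕ => 2 * B / N + T * (2 * ε') + 2 * B * √(T / N)) atTop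
      (nhds (T * (2 * ε'))) := by
    have h1 := tendsto_const_div_atTop_nhds_zero_nat (2 * B)
    have h2 := (tendsto_const_div_atTop_nhds_zero_nat T).sqrt.const_mul (2 * B)
    simpa using (h1.add_const (T * (2 * ε'))).add h2
  filter_upwards [hθC, hstep, hMN, hbound.eventually_lt_const hεT, eventually_gt_atTop 0]
    with N hNC hNs hNδ hNb hN0
  have hN : (0 : ℝ) < N := Nat.cast_pos.2 hN0
  refine lt_of_le_of_lt ?_ hNb
  have hmain := integral_abs_weighted_sum_le (P := P) (ℱ N) (hZ N)
    (κ := fun k ω => K (θ N k ω)) (fun k ω => hKs _)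
    (fun k s s' => Measurable.comp (g := fun e => K e s s')
      (by fun_prop : Continuous fun e => K e s s').measurable (hθ N k))
    (H := fun k ω => h (θ N k ω)) (g := fun k ω => g (θ N k ω)) (fun k ω => hhB _)
    (fun k s => Measurable.comp (g := fun e => h e s)
      (by fun_prop : Continuous fun e => h e s).measurable (hθ N k))
    (hcond N) (hw0 N) (hw1 N) (hw N) (ε := ε') (n := ⌊(N : ℝ) * T⌋₊)
    (fun k hk ω s => by
      have h1 := sum_iterate_sub_kerOp (K (θ N k ω)) (g (θ N k ω)) m s
      simp only [hh]
      rw [h1, sub_sub_cancel]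
      exact (abs_apply_le_norm _ s).trans (hm _ (hNC k hk.le ω)))
    (fun k hk ω s => by
      have h1 := hδh _ (hNC (k + 1) hk ω) _ (hNC k hk.le ω) ((hNs k ω).trans_lt hNδ)
      exact (dist_le_pi_dist _ _ s).trans h1.le)
  have hB : 0 ≤ B := (norm_nonneg _).trans
    (hhB (θ N 0 (nonempty_of_isProbabilityMeasure P).some))
  have hfl : (⌊(N : ℝ) * T⌋₊ : ℝ) ≤ N * T := Nat.floor_le (by positivity)
  have hsqrt : √(⌊(N : ℝ) * T⌋₊ : ℝ) ≤ N * √(T / N) := by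
    rw [← Real.sqrt_sq hN.le, ← Real.sqrt_mul (sq_nonneg _), Real.sqrt_sq hN.le]
    refine Real.sqrt_le_sqrt (hfl.trans_eq ?_)
    field_simp
  simp_rw [abs_mul, integral_const_mul]
  rw [abs_of_nonneg (by positivity), one_div, inv_mul_le_iff₀ hN]
  refine hmain.trans ?_
  have h1 : (N : ℝ) * (2 * B / N + T * (2 * ε') + 2 * B * √(T / N))
      = 2 * B + (N * T) * (2 * ε') + 2 * B * (N * √(T / N)) := by
    field_simp
  rw [h1]
  gcongr

end process

section actorCritic

variable {X A : Type*} [Fintype A]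

lemma softmaxPol_nonneg (θ : X → A → ℝ) (x : X) (a : A) : 0 ≤ softmaxPol θ x a :=
  div_nonneg (Real.exp_pos _).le (Finset.sum_nonneg fun _ _ => (Real.exp_pos _).le)

lemma sum_exp_pos [Nonempty A] (θ : X → A → ℝ) (x : X) : 0 < ∑ a, Real.exp (θ x a) :=
  Finset.sum_pos (fun _ _ => Real.exp_pos _) Finset.univ_nonempty

lemma sum_softmaxPol [Nonempty A] (θ : X → A → ℝ) (x : X) : ∑ a, softmaxPol θ x a = 1 := by
  simp_rw [softmaxPol]
  rw [← Finset.sum_div, div_self (sum_exp_pos θ x).ne']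

lemma softmaxPol_le_one [Nonempty A] (θ : X → A → ℝ) (x : X) (a : A) : softmaxPol θ x a ≤ 1 :=
  sum_softmaxPol θ x ▸ Finset.single_le_sum (fun a _ => softmaxPol_nonneg θ x a)
    (Finset.mem_univ a)

lemma continuous_softmaxPol [Nonempty A] (x : X) (a : A) :
    Continuous fun θ : X → A → ℝ => softmaxPol θ x a := by
  unfold softmaxPol
  exact Continuous.div (by fun_prop) (by fun_prop) fun θ => (sum_exp_pos θ x).ne'

lemma explorePol_nonneg {η : ℝ} (h0 : 0 ≤ η) (h1 : η ≤ 1) (θ : X → A → ℝ) (x : X) (a : A) :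
    0 ≤ explorePol η θ x a :=
  add_nonneg (by positivity) (mul_nonneg (by linarith) (softmaxPol_nonneg θ x a))

lemma sum_explorePol [Nonempty A] (η : ℝ) (θ : X → A → ℝ) (x : X) :
    ∑ a, explorePol η θ x a = 1 := by
  simp only [explorePol, Finset.sum_add_distrib, ← Finset.mul_sum, sum_softmaxPol,
    Finset.sum_const, Finset.card_univ, nsmul_eq_mul]
  field_simp
  ring

lemma etaN_mem_Icc (N k : ℕ) : etaN N k ∈ Set.Icc (0 : ℝ) 1 := by
  have : 1 ≤ 1 + (Real.log ((k : ℝ) / (N : ℝ) + 1)) ^ 2 :=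
    le_add_of_nonneg_right (sq_nonneg _)
  exact ⟨inv_nonneg.2 (by linarith), inv_le_one_of_one_le₀ this⟩

lemma zetaN_nonneg (N k : ℕ) : 0 ≤ zetaN N k := by unfold zetaN; positivity

lemma zetaN_le_one (N k : ℕ) : zetaN N k ≤ 1 :=
  inv_le_one_of_one_le₀ (le_add_of_nonneg_right (by positivity))

lemma antitone_zetaN (N : ℕ) : Antitone (zetaN N) := fun k l hkl => by
  unfold zetaN
  gcongr

lemma isStochastic_actorKer [Fintype X] {γ : ℝ} {p : X → A → X → ℝ} {μ : X → ℝ}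
    (hp0 : ∀ x a x', 0 ≤ p x a x') (hp1 : ∀ x a, ∑ x', p x a x' = 1)
    (hμ0 : ∀ x, 0 ≤ μ x) (hμ1 : ∑ x, μ x = 1) (hγ0 : 0 ≤ γ) (hγ1 : γ ≤ 1)
    {f : X → A → ℝ} (hf : IsPolicy f) : IsStochastic (actorKer γ p μ f) := by
  refine ⟨fun s s' => mul_nonneg (add_nonneg (mul_nonneg hγ0 (hp0 _ _ _))
    (mul_nonneg (by linarith) (hμ0 _))) (hf.1 _ _), fun s => ?_⟩
  simp only [actorKer, ptilde, Fintype.sum_prod_type, ← Finset.mul_sum, hf.2, mul_one,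
    Finset.sum_add_distrib, hp1, hμ1]
  ring

lemma continuous_actorKer_softmaxPol [Nonempty A] (γ : ℝ) (p : X → A → X → ℝ) (μ : X → ℝ) :
    Continuous fun θ : X → A → ℝ => actorKer γ p μ (softmaxPol θ) :=
  continuous_pi fun _ => continuous_pi fun s' =>
    continuous_const.mul (continuous_softmaxPol s'.1 s'.2)

lemma continuous_comp_softmaxPol_of_lipschitz [Fintype X] [Nonempty A]
    {σ : (X → A → ℝ) → X × A → ℝ} {L : ℝ}
    (hσ : ∀ f f' : X → A → ℝ,
      ∑ ξ : X × A, |σ f ξ - σ f' ξ| ≤ L * ∑ x, ∑ a, |f x a - f' x a|) (ξ : X × A) :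
    Continuous fun θ : X → A → ℝ => σ (softmaxPol θ) ξ := by
  refine continuous_iff_continuousAt.2 fun θ₀ => ?_
  refine tendsto_iff_norm_sub_tendsto_zero.2 (squeeze_zero (fun θ => norm_nonneg _)
    (fun θ => (Finset.single_le_sum (f := fun ξ => |σ (softmaxPol θ) ξ - σ (softmaxPol θ₀) ξ|)
      (fun ξ _ => abs_nonneg _) (Finset.mem_univ ξ)).trans (hσ _ _)) ?_)
  have hc : Continuous fun θ : X → A → ℝ =>
      L * ∑ x, ∑ a, |softmaxPol θ x a - softmaxPol θ₀ x a| :=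
    continuous_const.mul <| continuous_finsetSum _ fun x _ => continuous_finsetSum _ fun a _ =>
      ((continuous_softmaxPol x a).sub continuous_const).abs
  simpa using hc.tendsto θ₀

section measurability

variable {Ω : Type*} {mΩ : MeasurableSpace Ω} [Fintype X] [Nonempty A] {Q θ : Ω → X → A → ℝ}

lemma measurable_softmaxPol_comp (hθ : Measurable θ) (x : X) (a : A) :
    Measurable fun ω => softmaxPol (θ ω) x a :=
  (continuous_softmaxPol x a).measurable.comp hθ

variable [MeasurableSpace X] [MeasurableSingletonClass X] [MeasurableSpace A]
  [MeasurableSingletonClass A] [DecidableEq X] [DecidableEq A]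

lemma measurable_actor_update (hQ : Measurable Q) (hθ : Measurable θ) {z : Ω → X × A}
    (hz : Measurable z) (c : ℝ) (x : X) (a : A) :
    Measurable fun ω => θ ω x a + c * Q ω (z ω).1 (z ω).2 * (if (z ω).1 = x then 1 else 0) *
      ((if (z ω).2 = a then 1 else 0) - softmaxPol (θ ω) (z ω).1 a) := by
  refine measurable_apply_of_forall (f := fun ω s => θ ω x a + c * Q ω s.1 s.2 *
    (if s.1 = x then 1 else 0) * ((if s.2 = a then 1 else 0) - softmaxPol (θ ω) s.1 a)) hz ?_
  intro s
  have := measurable_softmaxPol_comp hθ s.1 a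
  fun_prop

lemma measurable_critic_update (hQ : Measurable Q) (hθ : Measurable θ) {z : Ω → X × A}
    (hz : Measurable z) {x' : Ω → X} (hx' : Measurable x') (c γ η : ℝ) (r : X → A → ℝ)
    (x : X) (a : A) :
    Measurable fun ω => Q ω x a + c * (r (z ω).1 (z ω).2 +
      γ * (∑ a'', Q ω (x' ω) a'' * explorePol η (θ ω) (x' ω) a'') - Q ω (z ω).1 (z ω).2) *
      (if (z ω).1 = x ∧ (z ω).2 = a then 1 else 0) := by
  refine measurable_apply_of_forall (f := fun ω (s : (X × A) × X) => Q ω x a +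
    c * (r s.1.1 s.1.2 + γ * (∑ a'', Q ω s.2 a'' * explorePol η (θ ω) s.2 a'')
      - Q ω s.1.1 s.1.2) * (if s.1.1 = x ∧ s.1.2 = a then 1 else 0)) (hz.prodMk hx') ?_
  intro s
  have := fun a'' => measurable_softmaxPol_comp hθ s.2 a''
  unfold explorePol
  fun_prop

end measurability

lemma abs_critic_update_le {q M c ρ γ v : ℝ} (hc0 : 0 ≤ c) (hc1 : c ≤ 1) (hγ : 0 ≤ γ)
    (hρ : |ρ| ≤ 1) (hq : |q| ≤ M) (hv : |v| ≤ M) (hM : 1 + γ * M ≤ M) :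
    |q + c * (ρ + γ * v - q)| ≤ M := by
  have h1 : |γ * v| ≤ γ * M := by
    rw [abs_mul, abs_of_nonneg hγ]; exact mul_le_mul_of_nonneg_left hv hγ
  have h2 : |ρ + γ * v| ≤ M := (abs_add_le _ _).trans (by linarith)
  rw [show q + c * (ρ + γ * v - q) = (1 - c) * q + c * (ρ + γ * v) by ring]
  refine (abs_add_le _ _).trans ?_
  rw [abs_mul, abs_mul, abs_of_nonneg hc0, abs_of_nonneg (sub_nonneg.2 hc1)]
  nlinarith [mul_le_mul_of_nonneg_left hq (sub_nonneg.2 hc1), mul_le_mul_of_nonneg_left h2 hc0]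

end actorCritic

theorem actor_sample_fluctuations_vanish
    {X A : Type*} [Fintype X] [Fintype A] [Nonempty X] [Nonempty A]
    [DecidableEq X] [DecidableEq A]
    (p : X → A → X → ℝ) (μ : X → ℝ) (r : X → A → ℝ) (γ α : ℝ)
    (hp0 : ∀ x a x', 0 ≤ p x a x') (hp1 : ∀ x a, ∑ x', p x a x' = 1)
    (hμ0 : ∀ x, 0 ≤ μ x) (hμ1 : ∑ x, μ x = 1)
    (hr : ∀ x a, 0 ≤ r x a ∧ r x a ≤ 1) (hγ : 0 < γ ∧ γ < 1) (hα : 0 < α)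
    (sigsta : (X → A → ℝ) → X × A → ℝ)
    (hsig : ∀ θ : X → A → ℝ,
      IsStationaryDist (actorKer γ p μ (softmaxPol θ)) (sigsta (softmaxPol θ)))
    (hsigLip : ∃ L : ℝ, ∀ f f' : X → A → ℝ,
      ∑ ξ : X × A, |sigsta f ξ - sigsta f' ξ| ≤ L * ∑ x, ∑ a, |f x a - f' x a|)
    (hergA : ∀ θ : X → A → ℝ, ∃ n, 0 < n ∧
      ∀ ξ ξ' : X × A, 0 < kpow (actorKer γ p μ (softmaxPol θ)) n ξ ξ')
    {Ω : Type*} [mΩ : MeasurableSpace Ω] (P : Measure Ω) [IsProbabilityMeasure P]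
    [MeasurableSpace X] [MeasurableSingletonClass X]
    [MeasurableSpace A] [MeasurableSingletonClass A]
    (Q0 θ0 : X → A → ℝ)
    (F : ℕ → MeasureTheory.Filtration ℕ mΩ)
    (xc : ℕ → ℕ → Ω → X) (ac : ℕ → ℕ → Ω → A)
    (xa : ℕ → ℕ → Ω → X) (aa : ℕ → ℕ → Ω → A)
    (Q θ : ℕ → ℕ → Ω → X → A → ℝ)
    (hQinit : ∀ N ω, Q N 0 ω = Q0) (hθinit : ∀ N ω, θ N 0 ω = θ0)
    (hQrec : ∀ N k ω x a, Q N (k + 1) ω x a = Q N k ω x a + (α / N) *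
      (r (xc N k ω) (ac N k ω) + γ * (∑ a'', Q N k ω (xc N (k + 1) ω) a'' *
          explorePol (etaN N k) (θ N k ω) (xc N (k + 1) ω) a'')
        - Q N k ω (xc N k ω) (ac N k ω)) *
      (if xc N k ω = x ∧ ac N k ω = a then 1 else 0))
    (hθrec : ∀ N k ω x a, θ N (k + 1) ω x a = θ N k ω x a + (zetaN N k / N) *
      Q N k ω (xa N k ω) (aa N k ω) * (if xa N k ω = x then 1 else 0) *
      ((if aa N k ω = a then 1 else 0) - softmaxPol (θ N k ω) (xa N k ω) a))
    (hadaptc : ∀ N k, Measurable[(F N) k] fun ω => (xc N k ω, ac N k ω))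
    (hadapta : ∀ N k, Measurable[(F N) k] fun ω => (xa N k ω, aa N k ω))
    (hMarkovC : ∀ N k (ξ' : X × A),
      (P[(fun ω => if (xc N (k + 1) ω, ac N (k + 1) ω) = ξ' then (1 : ℝ) else 0)|(F N) k])
        =ᵐ[P] fun ω => p (xc N k ω) (ac N k ω) ξ'.1 *
          explorePol (etaN N (k + 1)) (θ N (k + 1) ω) ξ'.1 ξ'.2)
    (hMarkovA : ∀ N k (ξ' : X × A),
      (P[(fun ω => if (xa N (k + 1) ω, aa N (k + 1) ω) = ξ' then (1 : ℝ) else 0)|(F N) k])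
        =ᵐ[P] fun ω => ptilde γ p μ (xa N k ω) (aa N k ω) ξ'.1 *
          softmaxPol (θ N (k + 1) ω) ξ'.1 ξ'.2)
    (ξ : X × A) (T : ℝ) (hT : 0 < T) :
    Tendsto (fun N : ℕ => ∫ ω, |(1 / (N : ℝ)) * ∑ k ∈ Finset.range ⌊(N : ℝ) * T⌋₊,
        zetaN N k * ((if (xa N k ω, aa N k ω) = ξ then (1 : ℝ) else 0) -
          sigsta (softmaxPol (θ N k ω)) ξ)| ∂P)
      atTop (nhds 0) := by
  obtain ⟨L, hL⟩ := hsigLip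
  obtain ⟨hγ0, hγ1⟩ := hγ
  set M : ℝ := max ‖Q0‖ (1 / (1 - γ)) with hMdef
  have hM0 : 0 ≤ M := (norm_nonneg _).trans (le_max_left _ _)
  have hMγ : 1 + γ * M ≤ M := by
    have h1 : 1 / (1 - γ) ≤ M := le_max_right _ _
    rw [div_le_iff₀ (by linarith)] at h1
    linarith
  have hQM : ∀ N : ℕ, α ≤ N → ∀ k ω x a, |Q N k ω x a| ≤ M := by
    intro N hN k ω
    have hN0 : (0 : ℝ) < N := hα.trans_le hN
    induction k with
    | zero =>
      intro x a
      rw [hQinit]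
      exact ((norm_le_pi_norm (Q0 x) a).trans (norm_le_pi_norm Q0 x)).trans (le_max_left _ _)
    | succ k ih =>
      intro x a
      rw [hQrec]
      split_ifs with h
      · obtain ⟨rfl, rfl⟩ := h
        rw [mul_one]
        refine abs_critic_update_le (by positivity) ((div_le_one hN0).2 hN) hγ0.le ?_ (ih _ _)
          ?_ hMγ
        · exact abs_le.2 ⟨by linarith [(hr (xc N k ω) (ac N k ω)).1], (hr _ _).2⟩
        · have h1 := abs_sum_mul_le_of_nonneg (explorePol_nonneg (etaN_mem_Icc N k).1
            (etaN_mem_Icc N k).2 (θ N k ω) (xc N (k + 1) ω)) (ih (xc N (k + 1) ω))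
          rw [sum_explorePol, one_mul] at h1
          simpa only [mul_comm] using h1
      · simpa using ih x a
  have hstep : ∀ N : ℕ, α ≤ N → ∀ k ω, dist (θ N (k + 1) ω) (θ N k ω) ≤ M / N := by
    intro N hN k ω
    have hMN : 0 ≤ M / N := by positivity
    refine (dist_pi_le_iff hMN).2 fun x => (dist_pi_le_iff hMN).2 fun a => ?_
    rw [hθrec, Real.dist_eq, add_sub_cancel_left, abs_mul, abs_mul, abs_mul]
    have h1 : |zetaN N k / N| ≤ 1 / N := by
      rw [abs_of_nonneg (div_nonneg (zetaN_nonneg N k) N.cast_nonneg)]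
      gcongr
      exact zetaN_le_one N k
    have h2 : |if xa N k ω = x then (1 : ℝ) else 0| ≤ 1 := by split_ifs <;> simp
    have h3 : |(if aa N k ω = a then (1 : ℝ) else 0) - softmaxPol (θ N k ω) (xa N k ω) a|
        ≤ 1 := by
      have h4 := softmaxPol_nonneg (θ N k ω) (xa N k ω) a
      have h5 := softmaxPol_le_one (θ N k ω) (xa N k ω) a
      rw [abs_le]
      split_ifs <;> constructor <;> linarith
    calc _ ≤ 1 / N * M * 1 * 1 := by
          gcongr
          exact hQM N hN k ω _ _
      _ = M / N := by ring
  have hadapt : ∀ N k, Measurable[F N k] (Q N k) ∧ Measurable[F N k] (θ N k) ∧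
      Measurable[F N k] (θ N (k + 1)) := by
    intro N k
    have hnext : ∀ k, Measurable[F N k] (Q N k) → Measurable[F N k] (θ N k) →
        Measurable[F N k] (θ N (k + 1)) := fun k hQk hθk => by
      refine measurable_of_forall_apply fun x a => ?_
      simp_rw [hθrec]
      exact measurable_actor_update hQk hθk (hadapta N k) _ x a
    suffices h : Measurable[F N k] (Q N k) ∧ Measurable[F N k] (θ N k) from
      ⟨h.1, h.2, hnext k h.1 h.2⟩
    induction k with
    | zero =>
      rw [funext (hQinit N), funext (hθinit N)]
      exact ⟨measurable_const, measurable_const⟩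
    | succ k ih =>
      have hle : F N k ≤ F N (k + 1) := (F N).mono k.le_succ
      refine ⟨measurable_of_forall_apply fun x a => ?_,
        (hnext k ih.1 ih.2).mono hle le_rfl⟩
      simp_rw [hQrec]
      exact measurable_critic_update (ih.1.mono hle le_rfl) (ih.2.mono hle le_rfl)
        ((hadaptc N k).mono hle le_rfl) (hadaptc N (k + 1)).fst _ γ _ r x a
  have hball : ∀ N : ℕ, α ≤ N → ∀ k ≤ ⌊(N : ℝ) * T⌋₊, ∀ ω,
      θ N k ω ∈ Metric.closedBall θ0 (M * T) := by
    intro N hN k hk ω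
    have hN0 : (0 : ℝ) < N := hα.trans_le hN
    have h1 : ∀ k : ℕ, dist (θ N k ω) θ0 ≤ k * (M / N) := by
      intro k
      induction k with
      | zero => simp [hθinit]
      | succ k ih =>
        refine (dist_triangle _ (θ N k ω) _).trans ?_
        push_cast
        linarith [hstep N hN k ω]
    have h2 : (k : ℝ) ≤ N * T :=
      (Nat.cast_le.2 hk).trans (Nat.floor_le (by positivity))
    refine (h1 k).trans ((mul_le_mul_of_nonneg_right h2 (by positivity)).trans_eq ?_)
    field_simp
  have hlarge : ∀ᶠ N : ℕ in atTop, α ≤ N := tendsto_natCast_atTop_atTop.eventually_ge_atTop α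
  have hstoch : ∀ ϑ : X → A → ℝ, IsStochastic (actorKer γ p μ (softmaxPol ϑ)) := fun ϑ =>
    isStochastic_actorKer hp0 hp1 hμ0 hμ1 hγ0.le hγ1.le
      ⟨softmaxPol_nonneg ϑ, sum_softmaxPol ϑ⟩
  set g : (X → A → ℝ) → X × A → ℝ := fun ϑ s =>
    (if s = ξ then (1 : ℝ) else 0) - sigsta (softmaxPol ϑ) ξ with hgdef
  refine tendsto_integral_abs_weighted_average (K := fun ϑ => actorKer γ p μ (softmaxPol ϑ))
    (g := g) (b := 1) (continuous_actorKer_softmaxPol γ p μ) ?_ hstoch ?_ ?_ F hadapta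
    (fun N k => (hadapt N k).2.2) hMarkovA zetaN_nonneg zetaN_le_one antitone_zetaN hT.le
    (isCompact_closedBall θ0 (M * T)) (hlarge.mono hball) (hlarge.mono hstep)
  · exact continuous_pi fun _ =>
      continuous_const.sub (continuous_comp_softmaxPol_of_lipschitz hL ξ)
  · refine fun ϑ => (pi_norm_le_iff_of_nonneg zero_le_one).2 fun s => ?_
    have h0 := (hsig ϑ).1 ξ
    have h1 : sigsta (softmaxPol ϑ) ξ ≤ 1 := (hsig ϑ).2.1 ▸
      Finset.single_le_sum (fun s _ => (hsig ϑ).1 s) (Finset.mem_univ ξ)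
    rw [Real.norm_eq_abs, abs_le]
    simp only [hgdef]
    split_ifs <;> constructor <;> linarith
  · intro ϑ
    obtain ⟨n, -, hn⟩ := hergA ϑ
    refine (hstoch ϑ).tendsto_norm_iterate_kerOp (hsig ϑ) hn ?_
    simp [hgdef, mul_sub, Finset.sum_sub_distrib, ← Finset.sum_mul, (hsig ϑ).2.1]
end
end
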